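/- arXiv:1501.03908 — 6 statements merged into one kernel-verified Lean document; each statement's English description precedes it below -/
import Mathlib

section
/- Let n ≥ 2 and let σ = {(i,j) ∈ Fin n × Fin n : i < j} × Fin 2 index n(n−1) real variables. In MvPolynomial σ ℂ, let Z be the antisymmetric n×n matrix whose (i,j) entry for i < j is X((i,j),0) + i·X((i,j),1), whose (j,i) entry for i < j is −(X((i,j),0) + i·X((i,j),1)), and whose diagonal entries are 0; let Z* be its entrywise formal conjugate transpose (the (j,i) entry for i < j being X((i,j),0) − i·X((i,j),1), etc.), and set D = det(I_n − Z·Z*) ∈ MvPolynomial σ ℂ. Then there exists an irreducible polynomial P ∈ MvPolynomial σ ℝ such that the square of the image of P under the coefficient ring map ℝ → ℂ equals D; that is, D is the square of the complexification of an irreducible real polynomial. -/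
open Matrix MvPolynomial

noncomputable section

/-- Index type for the real and imaginary parts of the strictly upper triangular entries of an
antisymmetric `n × n` matrix. -/
abbrev SigmaII (n : ℕ) := {p : Fin n × Fin n // p.1 < p.2} × Fin 2

/-- The formal antisymmetric matrix `Z`: for `i < j` the `(i,j)` entry is
`X((i,j),0) + i·X((i,j),1)`, the `(j,i)` entry is its negative, and the diagonal is `0`. -/
def ZpolyII (n : ℕ) : Matrix (Fin n) (Fin n) (MvPolynomial (SigmaII n) ℂ) :=
  Matrix.of fun a b =>
    if h : a < b then X (⟨(a, b), h⟩, 0) + C Complex.I * X (⟨(a, b), h⟩, 1)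
    else if h' : b < a then -(X (⟨(b, a), h'⟩, 0) + C Complex.I * X (⟨(b, a), h'⟩, 1))
    else 0

/-- The entrywise formal conjugate transpose `Z*` of `ZpolyII n`. -/
def ZpolyIIstar (n : ℕ) : Matrix (Fin n) (Fin n) (MvPolynomial (SigmaII n) ℂ) :=
  Matrix.of fun a b =>
    if h : b < a then X (⟨(b, a), h⟩, 0) - C Complex.I * X (⟨(b, a), h⟩, 1)
    else if h' : a < b then -(X (⟨(a, b), h'⟩, 0) - C Complex.I * X (⟨(a, b), h'⟩, 1))
    else 0

/-- The determinant of an antisymmetric matrix over a field of characteristic zero is a square. -/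
theorem isSquare_det_of_transpose_eq_neg_of_field {K : Type*} [Field K] [CharZero K] {ι : Type*}
    [Fintype ι] [DecidableEq ι] (A : Matrix ι ι K) (hA : Aᵀ = -A) : IsSquare A.det := by
  induction hN : Fintype.card ι using Nat.strong_induction_on generalizing ι with
  | _ N ih =>
  have hanti (i j : ι) : A j i = -A i j := congrFun (congrFun hA i) j
  by_cases hzero : A = 0
  · rcases isEmpty_or_nonempty ι with h | h
    · simp
    · simp [hzero]
  obtain ⟨i, j, hij⟩ : ∃ i j, A i j ≠ 0 := by
    by_contra! h
    exact hzero (by ext i j; exact h i j)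
  have hdiag (k : ι) : A k k = 0 := self_eq_neg.mp (hanti k k)
  have hne : i ≠ j := by
    rintro rfl
    exact hij (hdiag i)
  have hf : Function.Injective ![i, j] := by
    intro a b
    fin_cases a <;> fin_cases b <;> simp [hne, hne.symm]
  classical
  let κ := ↥((Set.range ![i, j])ᶜ)
  let e : Fin 2 ⊕ κ ≃ ι :=
    ((Equiv.ofInjective _ hf).sumCongr (Equiv.refl _)).trans (Equiv.Set.sumCompl _)
  have he (k : Fin 2) : e (Sum.inl k) = ![i, j] k :=
    Equiv.Set.sumCompl_apply_inl _ _
  have hcard : Fintype.card κ < N := by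
    rw [← hN, ← Fintype.card_congr e, Fintype.card_sum, Fintype.card_fin]
    lia
  let M := A.submatrix e e
  have hMt : Mᵀ = -M := by
    ext a b
    exact hanti _ _
  have hM₁₁ : M.toBlocks₁₁ = !![0, A i j; -A i j, 0] := by
    ext a b
    fin_cases a <;> fin_cases b <;> simp [M, toBlocks₁₁, he, hdiag, hanti i j]
  have hdet₁₁ : M.toBlocks₁₁.det = A i j * A i j := by
    rw [hM₁₁, det_fin_two_of]
    ring
  have hunit : IsUnit M.toBlocks₁₁.det := by
    rw [hdet₁₁]
    exact (mul_ne_zero hij hij).isUnit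
  have : Invertible M.toBlocks₁₁ := M.toBlocks₁₁.invertibleOfIsUnitDet hunit
  have ht₁₁ : M.toBlocks₁₁ᵀ = -M.toBlocks₁₁ := by
    ext a b
    exact hanti _ _
  have ht₁₂ : M.toBlocks₁₂ᵀ = -M.toBlocks₂₁ := by
    ext a b
    exact hanti _ _
  have ht₂₁ : M.toBlocks₂₁ᵀ = -M.toBlocks₁₂ := by
    ext a b
    exact hanti _ _
  have ht₂₂ : M.toBlocks₂₂ᵀ = -M.toBlocks₂₂ := by
    ext a b
    exact hanti _ _
  rw [← det_submatrix_equiv_self e A, show A.submatrix e e = M from rfl, ← fromBlocks_toBlocks M,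
    det_fromBlocks₁₁, hdet₁₁]
  refine (IsSquare.mul_self _).mul (ih _ hcard _ ?_ rfl)
  rw [transpose_sub, transpose_mul, transpose_mul, ht₁₂, ht₂₁, ht₂₂, invOf_eq_nonsing_inv,
    transpose_nonsing_inv, ht₁₁]
  have hinv : (-M.toBlocks₁₁)⁻¹ = -M.toBlocks₁₁⁻¹ := by
    apply inv_eq_left_inv
    rw [neg_mul_neg, nonsing_inv_mul _ hunit]
  rw [hinv]
  simp only [Matrix.neg_mul, Matrix.mul_neg, neg_neg, neg_sub, Matrix.mul_assoc]
  abel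

/-- The determinant of an antisymmetric matrix over an integrally closed domain of characteristic
zero is a square. -/
theorem isSquare_det_of_transpose_eq_neg {R : Type*} [CommRing R] [IsDomain R]
    [IsIntegrallyClosed R] [CharZero R] {ι : Type*} [Fintype ι] [DecidableEq ι]
    (A : Matrix ι ι R) (hA : Aᵀ = -A) : IsSquare A.det := by
  let K := FractionRing R
  have : CharZero K := IsFractionRing.charZero (R := R)
  obtain ⟨y, hy⟩ := isSquare_det_of_transpose_eq_neg_of_field (A.map (algebraMap R K)) (by
    rw [← transpose_map, hA]
    ext i j
    simp)
  obtain ⟨x, rfl⟩ : ∃ x, algebraMap R K x = y := by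
    refine IsIntegrallyClosed.exists_algebraMap_eq_of_isIntegral_pow (n := 2) two_pos ?_
    rw [sq, ← hy, ← RingHom.mapMatrix_apply, ← RingHom.map_det]
    exact isIntegral_algebraMap
  refine ⟨x, IsFractionRing.injective R K ?_⟩
  rw [map_mul, ← hy, ← RingHom.mapMatrix_apply, ← RingHom.map_det]

theorem isSquare_det_one_add_mul {R : Type*} [CommRing R] [IsDomain R]
    [IsIntegrallyClosed R] [CharZero R] {ι : Type*} [Fintype ι] [DecidableEq ι]
    (A B : Matrix ι ι R) (hA : Aᵀ = -A) (hB : Bᵀ = -B) : IsSquare (1 + A * B).det := by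
  have h : J ι R * fromBlocks A 1 (-1) B = fromBlocks 1 (-B) A 1 := by
    simp [J, fromBlocks_multiply]
  have hdet : (1 + A * B).det = (J ι R).det * (fromBlocks A 1 (-1) B).det := by
    rw [← det_mul, h, det_fromBlocks_one₁₁]
    simp
  rw [hdet]
  refine (isSquare_det_of_transpose_eq_neg _ (J_transpose ι R)).mul
    (isSquare_det_of_transpose_eq_neg _ ?_)
  simp [fromBlocks_transpose, hA, hB, fromBlocks_neg]

section Skew

variable {n : ℕ} {R S : Type*} [CommRing R] [CommRing S]

/-- The antisymmetric matrix with prescribed strictly upper triangular entries. -/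
def skew (f : {p : Fin n × Fin n // p.1 < p.2} → R) : Matrix (Fin n) (Fin n) R :=
  Matrix.of fun a b =>
    if h : a < b then f ⟨(a, b), h⟩ else if h' : b < a then -f ⟨(b, a), h'⟩ else 0

theorem skew_apply_of_lt (f : {p : Fin n × Fin n // p.1 < p.2} → R) {a b : Fin n} (h : a < b) :
    skew f a b = f ⟨(a, b), h⟩ := by
  simp [skew, h]

theorem skew_apply_of_gt (f : {p : Fin n × Fin n // p.1 < p.2} → R) {a b : Fin n} (h : b < a) :
    skew f a b = -f ⟨(b, a), h⟩ := by
  simp [skew, h, h.not_gt]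

@[simp]
theorem skew_apply_self (f : {p : Fin n × Fin n // p.1 < p.2} → R) (a : Fin n) :
    skew f a a = 0 := by
  simp [skew]

theorem skew_apply_swap (f : {p : Fin n × Fin n // p.1 < p.2} → R) (a b : Fin n) :
    skew f b a = -skew f a b := by
  rcases lt_trichotomy a b with h | rfl | h
  · rw [skew_apply_of_lt f h, skew_apply_of_gt f h]
  · simp
  · rw [skew_apply_of_lt f h, skew_apply_of_gt f h, neg_neg]

theorem skew_transpose (f : {p : Fin n × Fin n // p.1 < p.2} → R) : (skew f)ᵀ = -skew f := by
  ext a b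
  exact skew_apply_swap f a b

theorem map_skew_apply (φ : R →+* S) (f : {p : Fin n × Fin n // p.1 < p.2} → R) (a b : Fin n) :
    φ (skew f a b) = skew (fun p => φ (f p)) a b := by
  rcases lt_trichotomy a b with h | rfl | h
  · simp only [skew_apply_of_lt _ h]
  · simp
  · simp only [skew_apply_of_gt _ h, map_neg]

theorem map_det_one_add_skew_mul_skew (φ : R →+* S)
    (f g : {p : Fin n × Fin n // p.1 < p.2} → R) :
    φ (1 + skew f * skew g).det =
      (1 + skew (fun p => φ (f p)) * skew (fun p => φ (g p))).det := by
  have hmap (f : {p : Fin n × Fin n // p.1 < p.2} → R) :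
      φ.mapMatrix (skew f) = skew (fun p => φ (f p)) := by
    ext a b
    exact map_skew_apply φ f a b
  rw [RingHom.map_det, map_add, map_mul, map_one, hmap, hmap]

theorem skew_apply_eq_zero (f : {p : Fin n × Fin n // p.1 < p.2} → R) (a : Fin n)
    (hf : ∀ p, p.1.1 ≠ a → p.1.2 ≠ a → f p = 0) {i j : Fin n} (hi : i ≠ a) (hj : j ≠ a) :
    skew f i j = 0 := by
  rcases lt_trichotomy i j with h | rfl | h
  · rw [skew_apply_of_lt _ h, hf _ hi hj]
  · simp
  · rw [skew_apply_of_gt _ h, hf _ hj hi, neg_zero]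

/-- If `skew f` is supported on the row and the column of index `a`, then `det (1 + skew f * W)`
is an explicit square. -/
theorem det_one_add_skew_mul_skew_of_star (f g : {p : Fin n × Fin n // p.1 < p.2} → R) (a : Fin n)
    (hf : ∀ p, p.1.1 ≠ a → p.1.2 ≠ a → f p = 0) :
    (1 + skew f * skew g).det = (1 - ∑ i, skew f a i * skew g a i) ^ 2 := by
  let A : Matrix (Fin n) (Fin 2) R :=
    Matrix.of fun i k => (![(Pi.single a 1 : Fin n → R) i, -skew f a i] : Fin 2 → R) k
  let B : Matrix (Fin 2) (Fin n) R :=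
    Matrix.of fun k i => (![skew f a i, (Pi.single a 1 : Fin n → R) i] : Fin 2 → R) k
  have hAB : skew f = A * B := by
    ext i j
    rw [Matrix.mul_apply, Fin.sum_univ_two]
    simp only [A, B, Matrix.of_apply, Matrix.cons_val_zero, Matrix.cons_val_one, Pi.single_apply]
    by_cases hi : i = a
    · subst hi
      simp
    · by_cases hj : j = a
      · subst hj
        simp [hi, skew_apply_swap f j i]
      · simp [hi, hj, skew_apply_eq_zero f a hf hi hj]
  rw [hAB, Matrix.mul_assoc, det_one_add_mul_comm, det_fin_two]
  have hBg (j : Fin n) : (B * skew g) 1 j = skew g a j := by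
    simp [B, Matrix.mul_apply, Pi.single_apply]
  have hA (k : Fin n) : A k 0 = (Pi.single a 1 : Fin n → R) k := by simp [A]
  have h10 : (B * skew g * A) 1 0 = 0 := by
    simp [Matrix.mul_apply (M := B * skew g), hBg, hA, Pi.single_apply]
  have h11 : (B * skew g * A) 1 1 = -∑ i, skew f a i * skew g a i := by
    simp [Matrix.mul_apply (M := B * skew g), hBg, A, mul_comm]
  have h00 : (B * skew g * A) 0 0 = -∑ i, skew f a i * skew g a i := by
    simp only [Matrix.mul_apply (M := B * skew g), hA, Pi.single_apply]
    simp [B, Matrix.mul_apply, skew_apply_swap g a]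
  rw [← hAB]
  simp only [Matrix.add_apply, h10, h11, h00]
  simp
  ring

theorem det_one_add_skew_single_mul_skew_single (p : {p : Fin n × Fin n // p.1 < p.2}) (z w : R) :
    (1 + skew (Pi.single p z) * skew (Pi.single p w)).det = (1 - z * w) ^ 2 := by
  obtain ⟨⟨a, b⟩, hab⟩ := p
  have key (z : R) (i : Fin n) :
      skew (Pi.single (⟨(a, b), hab⟩ : {p : Fin n × Fin n // p.1 < p.2}) z) a i =
        if i = b then z else 0 := by
    rcases lt_trichotomy a i with h | rfl | h
    · rw [skew_apply_of_lt _ h]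
      simp [Pi.single_apply]
    · simp [(show a < b from hab).ne]
    · have h1 : i ≠ b := (h.trans hab).ne
      have h2 : ¬ (i = a ∧ a = b) := fun hh => h.ne hh.1
      rw [skew_apply_of_gt _ h]
      simp [h1, h2]
  rw [det_one_add_skew_mul_skew_of_star _ _ a]
  · simp [key]
  · intro q hq _
    rw [Pi.single_apply, if_neg]
    rintro rfl
    exact hq rfl

end Skew

theorem degreeOf_det_le {R σ ι : Type*} [CommRing R] [Fintype ι] [DecidableEq ι] (v : σ)
    (M : Matrix ι ι (MvPolynomial σ R)) (d : ι → ℕ) (h : ∀ i j, degreeOf v (M i j) ≤ d i) :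
    degreeOf v M.det ≤ ∑ i, d i := by
  rw [← det_transpose, det_apply]
  refine (degreeOf_sum_le _ _ _).trans (Finset.sup_le fun τ _ => ?_)
  have hsign : degreeOf v (Equiv.Perm.sign τ • ∏ i, Mᵀ (τ i) i) ≤ degreeOf v (∏ i, Mᵀ (τ i) i) := by
    rcases Int.units_eq_one_or (Equiv.Perm.sign τ) with hs | hs <;> simp [hs]
  refine hsign.trans ((degreeOf_prod_le _ _ _).trans (Finset.sum_le_sum fun i _ => ?_))
  exact h i (τ i)

theorem degreeOf_det_one_add_skew_mul_skew_le {R σ : Type*} [CommRing R] {n : ℕ} (v : σ)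
    (f g : {p : Fin n × Fin n // p.1 < p.2} → MvPolynomial σ R)
    (p : {p : Fin n × Fin n // p.1 < p.2}) (hfp : degreeOf v (f p) ≤ 1)
    (hf : ∀ q ≠ p, degreeOf v (f q) = 0) (hg : ∀ q, degreeOf v (g q) = 0) :
    degreeOf v (1 + skew f * skew g).det ≤ 2 := by
  have hgd (i j : Fin n) : degreeOf v (skew g i j) = 0 := by
    rcases lt_trichotomy i j with h | rfl | h
    · rw [skew_apply_of_lt _ h, hg]
    · simp
    · rw [skew_apply_of_gt _ h, degreeOf_neg, hg]
  have hfd' (q : {p : Fin n × Fin n // p.1 < p.2}) (i : Fin n) (hi : i = q.1.1 ∨ i = q.1.2) :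
      degreeOf v (f q) ≤ if i = p.1.1 ∨ i = p.1.2 then 1 else 0 := by
    by_cases hq : q = p
    · subst hq
      rwa [if_pos hi]
    · rw [hf q hq]
      exact Nat.zero_le _
  have hfd (i j : Fin n) :
      degreeOf v (skew f i j) ≤ if i = p.1.1 ∨ i = p.1.2 then 1 else 0 := by
    rcases lt_trichotomy i j with h | rfl | h
    · rw [skew_apply_of_lt _ h]
      exact hfd' _ i (Or.inl rfl)
    · simp
    · rw [skew_apply_of_gt _ h, degreeOf_neg]
      exact hfd' _ i (Or.inr rfl)
  refine (degreeOf_det_le v _ (fun i => if i = p.1.1 ∨ i = p.1.2 then 1 else 0) ?_).trans ?_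
  · intro i j
    rw [Matrix.add_apply, Matrix.mul_apply]
    refine (degreeOf_add_le _ _ _).trans (max_le ?_ ?_)
    · rw [Matrix.one_apply]
      split_ifs <;> simp
    · refine (degreeOf_sum_le _ _ _).trans (Finset.sup_le fun k _ => ?_)
      refine (degreeOf_mul_le _ _ _).trans ?_
      rw [hgd, add_zero]
      exact hfd i k
  · rw [Finset.sum_boole, Finset.filter_or, Finset.filter_eq', Finset.filter_eq']
    simpa using Finset.card_le_two

section Generic

variable {n : ℕ} {K : Type*} [Field K]

/-- The generic determinant `det (1 + Z * W)` for antisymmetric matrices `Z` and `W` with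
independent entries. -/
def genericDet (n : ℕ) (K : Type*) [Field K] : MvPolynomial (SigmaII n) K :=
  (1 + skew (fun p => X (p, 0)) * skew (fun p => X (p, 1)) :
    Matrix (Fin n) (Fin n) (MvPolynomial (SigmaII n) K)).det

theorem map_genericDet {S : Type*} [CommRing S] (φ : MvPolynomial (SigmaII n) K →+* S) :
    φ (genericDet n K) =
      (1 + skew (fun p => φ (X (p, 0))) * skew (fun p => φ (X (p, 1)))).det :=
  map_det_one_add_skew_mul_skew φ _ _

theorem degreeOf_genericDet_le (v : SigmaII n) : degreeOf v (genericDet n K) ≤ 2 := by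
  obtain ⟨p, k⟩ := v
  have hle (q : {p : Fin n × Fin n // p.1 < p.2}) (k : Fin 2) :
      degreeOf (p, k) (X (q, k) : MvPolynomial (SigmaII n) K) ≤ 1 := by
    classical
    rw [degreeOf_X]
    split_ifs <;> simp
  have hne (q : {p : Fin n × Fin n // p.1 < p.2}) (k l : Fin 2) (h : q ≠ p ∨ l ≠ k) :
      degreeOf (p, k) (X (q, l) : MvPolynomial (SigmaII n) K) = 0 := by
    apply degreeOf_X_of_ne
    rintro ⟨⟩
    simp at h
  fin_cases k
  · exact degreeOf_det_one_add_skew_mul_skew_le _ _ _ p (hle p 0)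
      (fun q hq => hne q 0 0 (Or.inl hq)) fun q => hne q 0 1 (Or.inr (by decide))
  · rw [genericDet, det_one_add_mul_comm]
    exact degreeOf_det_one_add_skew_mul_skew_le _ _ _ p (hle p 1)
      (fun q hq => hne q 1 1 (Or.inl hq)) fun q => hne q 1 0 (Or.inr (by decide))

/-- The substitution killing the entries of `Z` outside the row and the column of index `a`, and
fixing all the other variables. -/
def starSubst (K : Type*) [Field K] (a : Fin n) (v : SigmaII n) : MvPolynomial (SigmaII n) K :=
  if v.2 = 0 ∧ v.1.1.1 ≠ a ∧ v.1.1.2 ≠ a then 0 else X v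

/-- The pairing of the rows of index `a` of `Z` and `W`. -/
def starForm (K : Type*) [Field K] (a : Fin n) : MvPolynomial (SigmaII n) K :=
  ∑ i, skew (fun p => starSubst K a (p, 0)) a i * skew (fun p => X (p, 1)) a i

theorem bind₁_starSubst_genericDet (a : Fin n) :
    bind₁ (starSubst K a) (genericDet n K) = (1 - starForm K a) ^ 2 := by
  have h := map_genericDet (bind₁ (starSubst K a)).toRingHom
  simp only [AlgHom.toRingHom_eq_coe, RingHom.coe_coe, bind₁_X_right] at h
  rw [h, det_one_add_skew_mul_skew_of_star _ _ a]
  · simp [starForm, starSubst]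
  · intro p h1 h2
    simp [starSubst, h1, h2]

theorem irreducible_one_sub_starForm {a b : Fin n} (hab : a ≠ b) :
    Irreducible (1 - starForm K a) := by
  obtain ⟨p, hp, hterm⟩ : ∃ p : {p : Fin n × Fin n // p.1 < p.2},
      (p.1 = (a, b) ∨ p.1 = (b, a)) ∧
      skew (fun p => starSubst K a (p, 0)) a b * skew (fun p => X (p, 1)) a b =
        X (p, 1) * X (p, 0) := by
    rcases hab.lt_or_gt with h | h
    · refine ⟨⟨(a, b), h⟩, Or.inl rfl, ?_⟩
      rw [skew_apply_of_lt _ h, skew_apply_of_lt _ h]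
      simp [starSubst, mul_comm]
    · refine ⟨⟨(b, a), h⟩, Or.inr rfl, ?_⟩
      rw [skew_apply_of_gt _ h, skew_apply_of_gt _ h]
      simp [starSubst, mul_comm]
  set rest : MvPolynomial (SigmaII n) K := ∑ i ∈ Finset.univ.erase b,
    skew (fun p => starSubst K a (p, 0)) a i * skew (fun p => X (p, 1)) a i with hrest
  have hform : 1 - starForm K a = -X (p, 1) * X (p, 0) + (1 - rest) := by
    rw [starForm, ← Finset.add_sum_erase _ _ (Finset.mem_univ b), hterm]
    ring
  have hX (q : SigmaII n) (hq : q ≠ (p, 0)) : X q ∈ supported K {((p, 0) : SigmaII n)}ᶜ :=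
    X_mem_supported.mpr hq
  have hsupp : 1 - rest ∈ supported K {((p, 0) : SigmaII n)}ᶜ := by
    refine sub_mem (one_mem _) (sum_mem fun i hi => mul_mem ?_ ?_)
    · have hib : i ≠ b := Finset.ne_of_mem_erase hi
      have hs (q : {p : Fin n × Fin n // p.1 < p.2}) (hq : q ≠ p) :
          starSubst K a (q, 0) ∈ supported K {((p, 0) : SigmaII n)}ᶜ := by
        rw [starSubst]
        split_ifs
        · exact zero_mem _
        · exact hX _ (by simpa using hq)
      rcases lt_trichotomy a i with h | rfl | h
      · rw [skew_apply_of_lt _ h]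
        refine hs _ ?_
        rintro rfl
        simp at hp
        lia
      · rw [skew_apply_self]
        exact zero_mem _
      · rw [skew_apply_of_gt _ h]
        refine neg_mem (hs _ ?_)
        rintro rfl
        simp at hp
        lia
    · rcases lt_trichotomy a i with h | rfl | h
      · rw [skew_apply_of_lt _ h]
        exact hX _ (by simp)
      · rw [skew_apply_self]
        exact zero_mem _
      · rw [skew_apply_of_gt _ h]
        exact neg_mem (hX _ (by simp))
  have hconst : constantCoeff (1 - rest) = 1 := by
    have hz (i : Fin n) : constantCoeff
        (skew (fun p => (X (p, 1) : MvPolynomial (SigmaII n) K)) a i) = 0 := by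
      rw [map_skew_apply]
      simp [skew]
    simp [hrest, hz]
  rw [hform]
  refine irreducible_mul_X_add _ _ _ (by simp) ?_ ?_ ?_
  · rw [vars_neg, vars_X]
    simp
  · intro h
    exact mem_supported.mp hsupp h rfl
  · rw [IsRelPrime.neg_left_iff, X_prime.irreducible.isRelPrime_iff_not_dvd]
    intro h
    have := map_dvd (constantCoeff (R := K) (σ := SigmaII n)) h
    rw [hconst, constantCoeff_X] at this
    simp at this

theorem eval_single_genericDet (p : {p : Fin n × Fin n // p.1 < p.2}) (c : Fin 2 → K) :
    eval (fun v : SigmaII n => if v.1 = p then c v.2 else 0) (genericDet n K) =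
      (1 - c 0 * c 1) ^ 2 := by
  rw [map_genericDet, ← det_one_add_skew_single_mul_skew_single p]
  simp only [eval_X]
  congr 4 <;> ext q <;> simp [Pi.single_apply]

/-- If `F * G` is a square root of the generic determinant and `G` becomes a unit on the star of
`a`, then `F` involves all the variables of this star. -/
theorem mem_vars_of_isUnit_bind₁ {F G : MvPolynomial (SigmaII n) K}
    (hFG : (F * G) ^ 2 = genericDet n K) {a : Fin n} (hG : IsUnit (bind₁ (starSubst K a) G))
    (v : SigmaII n) (hv : v.1.1.1 = a ∨ v.1.1.2 = a) : v ∈ F.vars := by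
  by_contra hvF
  obtain ⟨p, k⟩ := v
  let x (c : Fin 2 → K) : SigmaII n → K := fun u => if u.1 = p then c u.2 else 0
  have hx (c : Fin 2 → K) : (eval (x c) F * eval (x c) G) ^ 2 = (1 - c 0 * c 1) ^ 2 := by
    rw [← map_mul, ← map_pow, hFG, eval_single_genericDet]
  have hcongr : eval (x 1) F = eval (x (Function.update 1 k 0)) F := by
    refine hom_congr_vars (by ext; simp) (fun u hu _ => ?_) rfl
    obtain ⟨q, l⟩ := u
    have : q ≠ p ∨ l ≠ k := by
      by_contra! h
      exact hvF (h.1 ▸ h.2 ▸ hu)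
    rcases this with h | h <;> simp [x, h]
  have h0 := hx (Function.update 1 k 0)
  have h1 := hx 1
  have hup : (Function.update 1 k 0 : Fin 2 → K) 0 * (Function.update 1 k 0 : Fin 2 → K) 1 = 0 := by
    fin_cases k <;> simp
  rw [hup, ← hcongr] at h0
  have hF : eval (x 1) F ≠ 0 := by
    intro h
    simp [h] at h0
  have hG0 : eval (x 1) G = 0 := by
    simpa [hF] using h1
  have hGs : eval (x 1) (bind₁ (starSubst K a) G) = eval (x 1) G := by
    rw [← RingHom.coe_coe (bind₁ _), ← RingHom.comp_apply]
    refine hom_congr_vars (by ext; simp) (fun u _ _ => ?_) rfl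
    rw [RingHom.comp_apply, RingHom.coe_coe, bind₁_X_right, starSubst]
    split_ifs with h
    · have hup : u.1 ≠ p := by
        rintro rfl
        exact hv.elim h.2.1 h.2.2
      simp [x, hup]
    · rfl
  have := hG.map (eval (x 1))
  rw [hGs, hG0] at this
  exact not_isUnit_zero this

theorem irreducible_of_sq_eq_genericDet (hn : 2 ≤ n) {Q : MvPolynomial (SigmaII n) K}
    (hQ : Q ^ 2 = genericDet n K) : Irreducible Q := by
  have hirr (a : Fin n) : Irreducible (bind₁ (starSubst K a) Q) := by
    have : Nontrivial (Fin n) := Fin.nontrivial_iff_two_le.mpr hn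
    obtain ⟨b, hb⟩ := exists_ne a
    have h := bind₁_starSubst_genericDet (K := K) a
    rw [← hQ, map_pow] at h
    rcases sq_eq_sq_iff_eq_or_eq_neg.mp h with h | h <;> rw [h]
    · exact irreducible_one_sub_starForm hb.symm
    · exact ((Associated.refl _).neg_left.irreducible_iff).mpr (irreducible_one_sub_starForm hb.symm)
  let a₀ : Fin n := ⟨0, by lia⟩
  have hQ0 : Q ≠ 0 := by
    rintro rfl
    simpa using (hirr a₀).ne_zero
  refine ⟨fun hu => (hirr a₀).not_isUnit (hu.map _), fun F G hFG => ?_⟩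
  subst hFG
  have hF0 : F ≠ 0 := left_ne_zero_of_mul hQ0
  have hG0 : G ≠ 0 := right_ne_zero_of_mul hQ0
  have hdisj (v : SigmaII n) (hF : v ∈ F.vars) (hG : v ∈ G.vars) : False := by
    have h := degreeOf_genericDet_le (K := K) v
    rw [← hQ, degreeOf_pow_eq _ _ _ hQ0, degreeOf_mul_eq hF0 hG0] at h
    rw [mem_vars_iff_degreeOf_ne_zero] at hF hG
    lia
  have hstar (a : Fin n) : (∀ v : SigmaII n, v.1.1.1 = a ∨ v.1.1.2 = a → v ∈ F.vars) ∨
      (∀ v : SigmaII n, v.1.1.1 = a ∨ v.1.1.2 = a → v ∈ G.vars) := by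
    rcases (hirr a).isUnit_or_isUnit (map_mul _ F G) with h | h
    · exact Or.inr (mem_vars_of_isUnit_bind₁ (by rw [mul_comm, hQ]) h)
    · exact Or.inl (mem_vars_of_isUnit_bind₁ hQ h)
  have hshare (a b : Fin n) (hF : ∀ v : SigmaII n, v.1.1.1 = a ∨ v.1.1.2 = a → v ∈ F.vars)
      (hG : ∀ v : SigmaII n, v.1.1.1 = b ∨ v.1.1.2 = b → v ∈ G.vars) : a = b := by
    rcases lt_trichotomy a b with h | h | h
    · exact (hdisj (⟨(a, b), h⟩, 0) (hF _ (Or.inl rfl)) (hG _ (Or.inr rfl))).elim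
    · exact h
    · exact (hdisj (⟨(b, a), h⟩, 0) (hF _ (Or.inr rfl)) (hG _ (Or.inl rfl))).elim
  have hunit (H : MvPolynomial (SigmaII n) K) (hH : H ≠ 0) (hv : ∀ v, v ∉ H.vars) : IsUnit H := by
    have h := vars_eq_empty_iff_eq_C.mp (Finset.eq_empty_of_forall_notMem hv)
    rw [h] at hH ⊢
    exact (IsUnit.mk0 _ (by simpa using hH)).map C
  rcases hstar a₀ with h | h
  · refine Or.inr (hunit G hG0 fun v hv => hdisj v ?_ hv)
    rcases hstar v.1.1.1 with h' | h'
    · exact h' v (Or.inl rfl)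
    · exact h v (Or.inl (hshare _ _ h h').symm)
  · refine Or.inl (hunit F hF0 fun v hv => hdisj v hv ?_)
    rcases hstar v.1.1.1 with h' | h'
    · exact h v (Or.inl (hshare _ _ h' h))
    · exact h' v (Or.inl rfl)

end Generic

theorem two_mul_C_half (σ : Type*) : (2 : MvPolynomial σ ℂ) * C (1 / 2) = 1 := by
  rw [← map_ofNat C 2, ← C_mul]
  norm_num

theorem C_neg_I_div_two_mul_C_I (σ : Type*) :
    (C (-Complex.I / 2) * C Complex.I : MvPolynomial σ ℂ) = C (1 / 2) := by
  rw [← C_mul]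
  congr 1
  linear_combination (-1 / 2 : ℂ) * Complex.I_mul_I

/-- The change of variables from `(z, w)` to real and imaginary parts, sending `z` to `x + i y`
and `w` to `x - i y`. -/
def complexCoordEquiv (τ : Type*) : MvPolynomial (τ × Fin 2) ℂ ≃ₐ[ℂ] MvPolynomial (τ × Fin 2) ℂ :=
  AlgEquiv.ofAlgHom
    (bind₁ fun v => X (v.1, 0) + (if v.2 = 0 then 1 else -1) * (C Complex.I * X (v.1, 1)))
    (bind₁ fun v => if v.2 = 0 then C (1 / 2) * (X (v.1, 0) + X (v.1, 1))
      else C (-Complex.I / 2) * (X (v.1, 0) - X (v.1, 1)))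
    (by
      ext1 ⟨p, k⟩
      fin_cases k
      · simp [-one_div]
        linear_combination X (p, 0) * two_mul_C_half (τ × Fin 2)
      · simp [-one_div]
        linear_combination X (p, 1) *
          (2 * C_neg_I_div_two_mul_C_I (τ × Fin 2) + two_mul_C_half (τ × Fin 2)))
    (by
      ext1 ⟨p, k⟩
      fin_cases k
      · simp [-one_div]
        linear_combination (X (p, 0) - X (p, 1)) * C_neg_I_div_two_mul_C_I (τ × Fin 2) +
          X (p, 0) * two_mul_C_half (τ × Fin 2)
      · simp [-one_div]
        linear_combination (X (p, 1) - X (p, 0)) * C_neg_I_div_two_mul_C_I (τ × Fin 2) +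
          X (p, 1) * two_mul_C_half (τ × Fin 2))

theorem complexCoordEquiv_X_zero {τ : Type*} (p : τ) :
    complexCoordEquiv τ (X (p, 0)) = X (p, 0) + C Complex.I * X (p, 1) := by
  simp [complexCoordEquiv]

theorem complexCoordEquiv_X_one {τ : Type*} (p : τ) :
    complexCoordEquiv τ (X (p, 1)) = X (p, 0) - C Complex.I * X (p, 1) := by
  simp [complexCoordEquiv, sub_eq_add_neg]

theorem ZpolyII_eq_skew (n : ℕ) :
    ZpolyII n = skew fun p => X (p, 0) + C Complex.I * X (p, 1) :=
  rfl

theorem ZpolyIIstar_eq_neg_skew (n : ℕ) :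
    ZpolyIIstar n = -skew fun p => X (p, 0) - C Complex.I * X (p, 1) := by
  ext1 a b
  rw [Matrix.neg_apply]
  rcases lt_trichotomy a b with h | rfl | h
  · rw [skew_apply_of_lt _ h]
    simp [ZpolyIIstar, h, h.not_gt]
  · simp [ZpolyIIstar]
  · rw [skew_apply_of_gt _ h]
    simp [ZpolyIIstar, h]

theorem det_one_sub_ZpolyII_mul_ZpolyIIstar (n : ℕ) :
    (1 - ZpolyII n * ZpolyIIstar n).det =
      (1 + skew (fun p => X (p, 0) + C Complex.I * X (p, 1)) *
        skew (fun p => X (p, 0) - C Complex.I * X (p, 1)) :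
          Matrix (Fin n) (Fin n) (MvPolynomial (SigmaII n) ℂ)).det := by
  rw [ZpolyII_eq_skew, ZpolyIIstar_eq_neg_skew, Matrix.mul_neg, sub_neg_eq_add]

/-- A complex polynomial whose square is invariant under conjugation of the coefficients and which
takes the value `1` or `-1` at the origin has real coefficients. -/
theorem exists_map_algebraMap_eq_of_sq {σ : Type*} {Q : MvPolynomial σ ℂ}
    (hQ : map (starRingEnd ℂ) (Q ^ 2) = Q ^ 2) (h0 : constantCoeff (Q ^ 2) = 1) :
    ∃ P : MvPolynomial σ ℝ, map (algebraMap ℝ ℂ) P = Q := by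
  have hconj : map (starRingEnd ℂ) Q = Q := by
    rw [map_pow] at hQ
    refine (sq_eq_sq_iff_eq_or_eq_neg.mp hQ).resolve_right fun h => ?_
    have h' := congrArg constantCoeff h
    rw [constantCoeff_map, map_neg] at h'
    rw [map_pow] at h0
    rcases sq_eq_one_iff.mp h0 with h1 | h1 <;> rw [h1] at h' <;> norm_num at h'
  have hreal (m : σ →₀ ℕ) : ((coeff m Q).re : ℂ) = coeff m Q := by
    rw [← Complex.conj_eq_iff_re, ← coeff_map, hconj]
  have : Q ∈ Set.range (map (σ := σ) (algebraMap ℝ ℂ)) := by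
    rw [mem_range_map_iff_coeffs_subset]
    intro c hc
    obtain ⟨m, -, rfl⟩ := mem_coeffs_iff.mp hc
    exact ⟨_, hreal m⟩
  exact this

theorem irreducible_of_irreducible_map {σ K L : Type*} [Field K] [Field L] (φ : K →+* L)
    {P : MvPolynomial σ K} (hP : Irreducible (map φ P)) : Irreducible P := by
  have hu (F : MvPolynomial σ K) (hF : IsUnit (map φ F)) : IsUnit F := by
    rw [isUnit_iff_totalDegree_of_isReduced] at hF ⊢
    rw [coeff_map, totalDegree, support_map_of_injective _ φ.injective] at hF
    exact ⟨(isUnit_map_iff φ _).mp hF.1, hF.2⟩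
  refine ⟨fun h => hP.not_isUnit (h.map _), fun F G hFG => ?_⟩
  rw [hFG, map_mul] at hP
  exact (hP.isUnit_or_isUnit rfl).imp (hu F) (hu G)

/-- Proposition 3.2, type II case: `det(I_n − Z Zᴴ)` on antisymmetric matrices is the square of
the complexification of an irreducible real polynomial (the generic norm `S^II_n`). -/
theorem genericNorm_typeII_irreducible_sqrt (n : ℕ) (hn : 2 ≤ n) :
    ∃ P : MvPolynomial (SigmaII n) ℝ, Irreducible P ∧
      (MvPolynomial.map (algebraMap ℝ ℂ) P) ^ 2 = (1 - ZpolyII n * ZpolyIIstar n).det := by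
  obtain ⟨Q, hQ⟩ : IsSquare (genericDet n ℂ) := by
    exact isSquare_det_one_add_mul _ _ (skew_transpose _) (skew_transpose _)
  have hirr : Irreducible Q := irreducible_of_sq_eq_genericDet hn (by rw [hQ, sq])
  let e := complexCoordEquiv {p : Fin n × Fin n // p.1 < p.2}
  have heQ : e Q ^ 2 = (1 - ZpolyII n * ZpolyIIstar n).det := by
    rw [← map_pow, sq, ← hQ, det_one_sub_ZpolyII_mul_ZpolyIIstar]
    have h := map_genericDet (n := n) (K := ℂ) (e : _ →+* MvPolynomial (SigmaII n) ℂ)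
    simp only [RingHom.coe_coe, e, complexCoordEquiv_X_zero, complexCoordEquiv_X_one] at h
    exact h
  obtain ⟨P, hP⟩ := exists_map_algebraMap_eq_of_sq (Q := e Q) (by
      rw [heQ, det_one_sub_ZpolyII_mul_ZpolyIIstar, map_det_one_add_skew_mul_skew,
        det_one_add_mul_comm]
      simp [sub_eq_add_neg]) (by
      rw [heQ, det_one_sub_ZpolyII_mul_ZpolyIIstar, map_det_one_add_skew_mul_skew]
      have h0 : skew (fun _ : {p : Fin n × Fin n // p.1 < p.2} => (0 : ℂ)) = 0 := by
        ext a b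
        simp [skew]
      simp [h0])
  refine ⟨P, irreducible_of_irreducible_map (algebraMap ℝ ℂ) ?_, by rw [hP, heQ]⟩
  rw [hP]
  exact (MulEquiv.irreducible_iff e).mpr hirr
end
end

section
/- Let n ≥ 3 and let σ = Fin n × Fin 2 index 2n real variables. In MvPolynomial σ ℂ, set z_k = X(k,0) + i·X(k,1) and z̄_k = X(k,0) − i·X(k,1), and define D = 1 − 2·Σ_{k} z_k z̄_k + (Σ_k z_k²)·(Σ_k z̄_k²) ∈ MvPolynomial σ ℂ. Then there exists a (necessarily unique) polynomial P ∈ MvPolynomial σ ℝ whose image under the coefficient ring map ℝ → ℂ equals D, and P is irreducible in MvPolynomial σ ℝ. -/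
open MvPolynomial

noncomputable section

/-- The formal variable `z_k = X(k,0) + i·X(k,1)`. -/
def zIV (n : ℕ) (k : Fin n) : MvPolynomial (Fin n × Fin 2) ℂ :=
  X (k, 0) + C Complex.I * X (k, 1)

/-- The formal conjugate variable `z̄_k = X(k,0) − i·X(k,1)`. -/
def zIVbar (n : ℕ) (k : Fin n) : MvPolynomial (Fin n × Fin 2) ℂ :=
  X (k, 0) - C Complex.I * X (k, 1)

/-- An even monic quartic `X⁴ + 2bX² + c` over a domain is irreducible as soon as neither
its discriminant `4(b² - c)` as a quadratic in `X²` nor `c` is a square. -/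
theorem irreducible_even_quartic {R : Type*} [CommRing R] [IsDomain R]
    {b c : R} (hd : ¬ IsSquare (4 * (b ^ 2 - c))) (hc : ¬ IsSquare c) :
    Irreducible (Polynomial.X ^ 4 + Polynomial.C (2 * b) * Polynomial.X ^ 2 + Polynomial.C c :
      Polynomial R) := by
  set p : Polynomial R :=
    Polynomial.X ^ 4 + Polynomial.C (2 * b) * Polynomial.X ^ 2 + Polynomial.C c with hp
  have hdeg : p.natDegree = 4 := by rw [hp]; compute_degree!
  have hmonic : p.Monic := by rw [hp]; monicity!
  rw [hmonic.irreducible_iff_natDegree']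
  refine ⟨fun h => by simp [h] at hdeg, fun f g hf hg hfg hmem => ?_⟩
  have hsum : f.natDegree + g.natDegree = 4 := by
    rw [← hf.natDegree_mul hg, hfg, hdeg]
  rw [hdeg, Finset.mem_Ioc] at hmem
  obtain hg1 | hg2 : g.natDegree = 1 ∨ g.natDegree = 2 := by omega
  · have hgX := hg.eq_X_add_C hg1
    have hroot : p.eval (-g.coeff 0) = 0 := by
      rw [← hfg, hgX]
      simp
    simp only [hp, Polynomial.eval_add, Polynomial.eval_mul, Polynomial.eval_pow,
      Polynomial.eval_X, Polynomial.eval_C] at hroot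
    exact hd ⟨2 * (g.coeff 0 ^ 2 + b), by linear_combination -4 * hroot⟩
  · have quadratic : ∀ h : Polynomial R, h.Monic → h.natDegree = 2 →
        h = Polynomial.X ^ 2 + Polynomial.C (h.coeff 1) * Polynomial.X
          + Polynomial.C (h.coeff 0) := by
      intro h hh h2
      conv_lhs => rw [hh.as_sum, h2]
      simp only [Finset.sum_range_succ, Finset.sum_range_zero]
      ring
    have hf2 := quadratic f hf (by omega)
    have hg2 := quadratic g hg hg2
    generalize f.coeff 1 = u at hf2
    generalize f.coeff 0 = q at hf2
    generalize g.coeff 1 = v at hg2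
    generalize g.coeff 0 = r at hg2
    have hexp : p = Polynomial.X ^ 4 + Polynomial.C (u + v) * Polynomial.X ^ 3
        + Polynomial.C (q + r + u * v) * Polynomial.X ^ 2
        + Polynomial.C (u * r + v * q) * Polynomial.X + Polynomial.C (q * r) := by
      rw [← hfg, hf2, hg2]
      simp only [map_add, map_mul]
      ring
    have h0 := congrArg (Polynomial.coeff · 0) hexp
    have h1 := congrArg (Polynomial.coeff · 1) hexp
    have h2 := congrArg (Polynomial.coeff · 2) hexp
    have h3 := congrArg (Polynomial.coeff · 3) hexp
    simp only [hp, Polynomial.coeff_add, Polynomial.coeff_C_mul, Polynomial.coeff_X_pow,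
      Polynomial.coeff_X, Polynomial.coeff_C] at h0 h1 h2 h3
    norm_num at h0 h1 h2 h3
    have huv : v = -u := by linear_combination -h3
    subst huv
    have hprod : u * (r - q) = 0 := by linear_combination -h1
    rcases mul_eq_zero.mp hprod with hu | hrq
    · subst hu
      exact hd ⟨q - r, by linear_combination (2 * b + q + r) * h2 - 4 * h0⟩
    · have : r = q := sub_eq_zero.mp hrq
      subst this
      exact hc ⟨r, h0⟩

/-- A real polynomial taking a negative value is not a square. -/
theorem not_isSquare_of_eval_neg {p : Polynomial ℝ} (t : ℝ) (h : p.eval t < 0) :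
    ¬ IsSquare p := by
  rintro ⟨r, rfl⟩
  rw [Polynomial.eval_mul] at h
  exact absurd h (not_lt.mpr (mul_self_nonneg _))

/-- A multivariate polynomial which is monic in the variable `i` is irreducible as soon as some
specialization of the remaining variables makes it irreducible. -/
theorem MvPolynomial.irreducible_of_monic_of_irreducible_specialization {σ R S : Type*}
    [DecidableEq σ] [CommRing R] [IsDomain R] [CommRing S] [IsDomain S] [Algebra R S]
    (i : σ) (w : σ → S) (P : MvPolynomial σ R)
    (hmonic : (aeval (fun j => if j = i then Polynomial.X else Polynomial.C (X j)) P :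
      Polynomial (MvPolynomial σ R)).Monic)
    (hirr : Irreducible
      (aeval (fun j => if j = i then Polynomial.X else Polynomial.C (w j)) P : Polynomial S)) :
    Irreducible P := by
  set ψ : MvPolynomial σ R →ₐ[R] Polynomial (MvPolynomial σ R) :=
    aeval (fun j => if j = i then Polynomial.X else Polynomial.C (X j)) with hψ
  have hleft : ∀ F, (ψ F).eval (X i) = F := by
    intro F
    have : ((Polynomial.aeval (X i : MvPolynomial σ R)).restrictScalars R).comp ψ
        = AlgHom.id R _ := by
      ext j
      by_cases hj : j = i <;> simp [hψ, hj]
    simpa [Polynomial.coe_aeval_eq_eval] using DFunLike.congr_fun this F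
  have hmap : Polynomial.mapAlgHom (aeval w : MvPolynomial σ R →ₐ[R] S) (ψ P)
      = aeval (fun j => if j = i then Polynomial.X else Polynomial.C (w j)) P := by
    rw [← AlgHom.comp_apply]
    congr 1
    ext j : 1
    by_cases hj : j = i <;> simp [hψ, hj]
  have hψP : Irreducible (ψ P) := by
    refine hmonic.irreducible_of_irreducible_map
      (aeval w : MvPolynomial σ R →ₐ[R] S).toRingHom _ ?_
    rw [← hmap] at hirr
    exact hirr
  have hunit : ∀ F, IsUnit (ψ F) → IsUnit F := fun F hF => by
    have := hF.map (Polynomial.evalRingHom (X i : MvPolynomial σ R))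
    rwa [Polynomial.coe_evalRingHom, hleft] at this
  refine ⟨fun h => hψP.not_isUnit (h.map ψ), fun F G hFG => ?_⟩
  exact (hψP.isUnit_or_isUnit (by rw [hFG, map_mul])).imp (hunit F) (hunit G)

/-- The generic norm of the Lie ball in real coordinates:
`1 - 2(|x|² + |y|²) + (|x|² - |y|²)² + 4⟨x, y⟩²`. -/
def genericNormIV (n : ℕ) : MvPolynomial (Fin n × Fin 2) ℝ :=
  1 - 2 * (∑ k, X (k, 0) ^ 2 + ∑ k, X (k, 1) ^ 2)
    + (∑ k, X (k, 0) ^ 2 - ∑ k, X (k, 1) ^ 2) ^ 2 + 4 * (∑ k, X (k, 0) * X (k, 1)) ^ 2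

theorem map_genericNormIV (n : ℕ) :
    MvPolynomial.map (algebraMap ℝ ℂ) (genericNormIV n)
      = 1 - 2 * (∑ k, zIV n k * zIVbar n k)
        + (∑ k, zIV n k ^ 2) * (∑ k, zIVbar n k ^ 2) := by
  have hI : (C Complex.I : MvPolynomial (Fin n × Fin 2) ℂ) ^ 2 = -1 := by
    rw [← C_pow, Complex.I_sq, C_neg, C_1]
  have hnorm : ∑ k, zIV n k * zIVbar n k = ∑ k, X (k, 0) ^ 2 + ∑ k, X (k, 1) ^ 2 := by
    rw [← Finset.sum_add_distrib]
    refine Finset.sum_congr rfl fun k _ => ?_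
    rw [zIV, zIVbar]
    linear_combination -(X (k, 1)) ^ 2 * hI
  have hsq : ∑ k, zIV n k ^ 2 = (∑ k, X (k, 0) ^ 2 - ∑ k, X (k, 1) ^ 2)
      + 2 * C Complex.I * ∑ k, X (k, 0) * X (k, 1) := by
    rw [← Finset.sum_sub_distrib, Finset.mul_sum, ← Finset.sum_add_distrib]
    refine Finset.sum_congr rfl fun k _ => ?_
    rw [zIV]
    linear_combination (X (k, 1)) ^ 2 * hI
  have hsqbar : ∑ k, zIVbar n k ^ 2 = (∑ k, X (k, 0) ^ 2 - ∑ k, X (k, 1) ^ 2)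
      - 2 * C Complex.I * ∑ k, X (k, 0) * X (k, 1) := by
    rw [← Finset.sum_sub_distrib, Finset.mul_sum, ← Finset.sum_sub_distrib]
    refine Finset.sum_congr rfl fun k _ => ?_
    rw [zIVbar]
    linear_combination (X (k, 1)) ^ 2 * hI
  rw [hnorm, hsq, hsqbar, genericNormIV]
  simp only [map_add, map_sub, map_mul, map_pow, map_sum, map_X, map_one, map_ofNat]
  linear_combination 4 * (∑ k, X (k, 0) * X (k, 1)) ^ 2 * hI

theorem aeval_genericNormIV_succ {A : Type*} [CommRing A] [Algebra ℝ A] (m : ℕ)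
    (w : Fin (m + 1) × Fin 2 → A) :
    (aeval (fun j => if j = (0, 0) then Polynomial.X else Polynomial.C (w j))
        (genericNormIV (m + 1)) : Polynomial A)
      = Polynomial.X ^ 4
        + Polynomial.C (2 * (∑ k : Fin m, w (k.succ, 0) ^ 2 + w (0, 1) ^ 2
            - ∑ k : Fin m, w (k.succ, 1) ^ 2 - 1)) * Polynomial.X ^ 2
        + Polynomial.C (8 * w (0, 1) * ∑ k : Fin m, w (k.succ, 0) * w (k.succ, 1))
          * Polynomial.X
        + Polynomial.C (1 - 2 * (∑ k : Fin m, w (k.succ, 0) ^ 2 + ∑ k, w (k, 1) ^ 2)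
            + (∑ k : Fin m, w (k.succ, 0) ^ 2 - ∑ k, w (k, 1) ^ 2) ^ 2
            + 4 * (∑ k : Fin m, w (k.succ, 0) * w (k.succ, 1)) ^ 2) := by
  simp only [genericNormIV, map_add, map_sub, map_mul, map_pow, map_sum, aeval_X, map_one,
    map_ofNat, Fin.sum_univ_succ, Prod.mk.injEq, Fin.succ_ne_zero, one_ne_zero, and_true,
    and_false, if_true, if_false]
  ring

theorem irreducible_genericNormIV (m : ℕ) : Irreducible (genericNormIV (m + 3)) := by
  -- Restrict to the plane `x = (s, 0, 1, 0, …)`, `y = (t, 3/2, 0, 0, …)`.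
  let x : Fin (m + 3) → Polynomial ℝ := Fin.cons 0 (Fin.cons 0 (Fin.cons 1 0))
  let y : Fin (m + 3) → Polynomial ℝ :=
    Fin.cons Polynomial.X (Fin.cons (Polynomial.C (3 / 2)) 0)
  refine irreducible_of_monic_of_irreducible_specialization (0, 0)
    (fun j => if j.2 = 0 then x j.1 else y j.1) _ ?_ ?_
  · rw [aeval_genericNormIV_succ]
    monicity!
  · rw [aeval_genericNormIV_succ]
    have hy : (Polynomial.C (3 / 2 : ℝ)) ^ 2 = Polynomial.C (9 / 4) := by
      rw [← Polynomial.C_pow]; norm_num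
    have key := irreducible_even_quartic
      (b := (Polynomial.X ^ 2 - Polynomial.C (9 / 4) : Polynomial ℝ))
      (c := (Polynomial.X ^ 2 + Polynomial.C (9 / 4)) *
        (Polynomial.X ^ 2 + Polynomial.C (9 / 4) - 4))
      (not_isSquare_of_eval_neg 2 (by norm_num)) (not_isSquare_of_eval_neg 0 (by norm_num))
    convert key using 1
    have hC2 : (Polynomial.C 2 : Polynomial (Polynomial ℝ)) = 2 := map_ofNat _ 2
    have hC4 : (Polynomial.C 4 : Polynomial (Polynomial ℝ)) = 4 := map_ofNat _ 4
    simp [Fin.sum_univ_succ, x, y, hy, hC2, hC4]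
    ring

/-- Proposition 3.2, type IV case: the generic norm
`S^IV_n = 1 − 2 Σ z_k z̄_k + (Σ z_k²)(Σ z̄_k²)` of the Lie ball, viewed as a real polynomial in
the real and imaginary parts `X(k,0), X(k,1)`, is irreducible for `n ≥ 3`. -/
theorem genericNorm_typeIV_irreducible (n : ℕ) (hn : 3 ≤ n) :
    ∃ P : MvPolynomial (Fin n × Fin 2) ℝ,
      MvPolynomial.map (algebraMap ℝ ℂ) P
          = 1 - 2 * (∑ k, zIV n k * zIVbar n k)
            + (∑ k, zIV n k ^ 2) * (∑ k, zIVbar n k ^ 2) ∧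
        Irreducible P := by
  obtain ⟨m, rfl⟩ := Nat.exists_eq_add_of_le' hn
  exact ⟨genericNormIV (m + 3), map_genericNormIV _, irreducible_genericNormIV m⟩
end
end

section
/- Let 1 ≤ r ≤ s and 1 ≤ r' ≤ s', and let f : Matrix (Fin r) (Fin s) ℂ → Matrix (Fin r') (Fin s') ℂ be a holomorphic polynomial map that maps Ω^I_{r,s} into Ω^I_{r',s'} and whose restriction Ω^I_{r,s} → Ω^I_{r',s'} is proper. Then there exists a polynomial map F : Matrix (Fin r) (Fin s) ℂ × Matrix (Fin r) (Fin s) ℂ → ℂ (each value F(Z,V) being a polynomial with complex coefficients in the entries of Z and of V jointly) such that for all Z, W ∈ Matrix (Fin r) (Fin s) ℂ: det(I_{r'} − f(Z)·f(W)ᴴ) = det(I_r − Z·Wᴴ) · F(Z, conj(W)), where conj(W) is the entrywise complex conjugate of W. -/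
open Matrix
open scoped ComplexOrder

noncomputable section

/-- The type I classical bounded symmetric domain `Ω^I_{r,s}`. -/
def OmegaI (r s : ℕ) : Set (Matrix (Fin r) (Fin s) ℂ) :=
  {Z | (1 - Z * Zᴴ).PosDef}

/-- `f` is a holomorphic polynomial map between complex matrix spaces. -/
def IsPolyMapI {r s r' s' : ℕ}
    (f : Matrix (Fin r) (Fin s) ℂ → Matrix (Fin r') (Fin s') ℂ) : Prop :=
  ∀ i j, ∃ p : MvPolynomial (Fin r × Fin s) ℂ,
    ∀ Z, f Z i j = MvPolynomial.eval (fun q => Z q.1 q.2) p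

/-- Properness of the restriction `Ω₁ → Ω₂`. -/
def IsProperOn {E F : Type*} [TopologicalSpace E] [TopologicalSpace F]
    (f : E → F) (Ω₁ : Set E) (Ω₂ : Set F) : Prop :=
  ∀ K : Set F, K ⊆ Ω₂ → IsCompact K → IsCompact (Ω₁ ∩ f ⁻¹' K)

/-- The point of the polarized coordinate space with coordinates `(Z, V)`. -/
def polarPoint {r s : ℕ} (Z V : Matrix (Fin r) (Fin s) ℂ) :
    (Fin r × Fin s) ⊕ (Fin r × Fin s) → ℂ :=
  Sum.elim (fun q => Z q.1 q.2) (fun q => V q.1 q.2)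

theorem MvPolynomial.eval_bind₁_apply {σ τ : Type*} (φ : σ → MvPolynomial τ ℂ) (x : τ → ℂ)
    (p : MvPolynomial σ ℂ) :
    MvPolynomial.eval x (MvPolynomial.bind₁ φ p) =
      MvPolynomial.eval (fun i => MvPolynomial.eval x (φ i)) p := by
  simpa [MvPolynomial.aeval_eq_eval] using
    MvPolynomial.aeval_bind₁ (S := ℂ) x φ p

/-- A polynomial in `(x, y)` vanishing on `y = conj x` for `x` in the open unit polydisc is zero. -/
theorem MvPolynomial.eq_zero_of_eval_conj_eq_zero {τ : Type*} (p : MvPolynomial (τ ⊕ τ) ℂ)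
    (h : ∀ x : τ → ℂ, (∀ j, ‖x j‖ < 1) →
      MvPolynomial.eval (Sum.elim x (fun j => starRingEnd ℂ (x j))) p = 0) : p = 0 := by
  set φ : τ ⊕ τ → MvPolynomial (τ ⊕ τ) ℂ := Sum.elim
    (fun j => X (Sum.inl j) + C Complex.I * X (Sum.inr j))
    (fun j => X (Sum.inl j) - C Complex.I * X (Sum.inr j)) with hφ
  have hq : bind₁ φ p = 0 := by
    refine MvPolynomial.funext_set
      (fun _ => (fun t : ℝ => (t : ℂ)) '' Set.Ioo 0 (1 / 2)) (fun _ => ?_) ?_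
    · exact (Set.Ioo_infinite (by norm_num)).image Complex.ofReal_injective.injOn
    · intro y hy
      choose t ht hty using fun i => hy i (Set.mem_univ i)
      simp only at hty
      rw [eval_bind₁_apply, map_zero,
        ← h (fun j => (t (Sum.inl j) : ℂ) + Complex.I * t (Sum.inr j))]
      · congr 2
        funext i
        rcases i with j | j
        · simp [hφ, ← hty]
        · simp [hφ, ← hty, sub_eq_add_neg]
      · intro j
        have h1 := ht (Sum.inl j)
        have h2 := ht (Sum.inr j)
        calc ‖(t (Sum.inl j) : ℂ) + Complex.I * t (Sum.inr j)‖
            ≤ ‖(t (Sum.inl j) : ℂ)‖ + ‖Complex.I * t (Sum.inr j)‖ := norm_add_le _ _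
          _ = t (Sum.inl j) + t (Sum.inr j) := by
              simp [abs_of_pos h1.1, abs_of_pos h2.1]
          _ < 1 := by linarith [h1.2, h2.2]
  refine MvPolynomial.funext fun y => ?_
  have := congrArg (eval (Sum.elim (fun j => (y (Sum.inl j) + y (Sum.inr j)) / 2)
    (fun j => (y (Sum.inl j) - y (Sum.inr j)) / (2 * Complex.I)))) hq
  rw [eval_bind₁_apply, map_zero] at this
  rw [map_zero, ← this]
  congr 2
  funext i
  rcases i with j | j
  · simp [hφ]; field_simp; ring
  · simp [hφ]; field_simp; ring

/-- Homogenization: `g(μ, x) = μ ^ N * p(x / μ)`, as a polynomial in `μ`. -/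
theorem MvPolynomial.exists_homogenization {τ : Type*} (p : MvPolynomial τ ℂ) :
    ∃ (N : ℕ) (g : Polynomial (MvPolynomial τ ℂ)), g.eval 1 = p ∧
      ∀ (x : τ → ℂ) (μ : ℂ), μ ≠ 0 →
        (g.map (MvPolynomial.eval x)).eval μ = μ ^ N * MvPolynomial.eval (fun i => x i / μ) p := by
  induction p using MvPolynomial.induction_on with
  | C a => exact ⟨0, Polynomial.C (C a), by simp, by simp⟩
  | add p q hp hq =>
    obtain ⟨M, g, hg1, hg⟩ := hp
    obtain ⟨N, k, hk1, hk⟩ := hq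
    refine ⟨M + N, Polynomial.X ^ N * g + Polynomial.X ^ M * k, by simp [hg1, hk1], ?_⟩
    intro x μ hμ
    simp [hg x μ hμ, hk x μ hμ]
    ring
  | mul_X p i hp =>
    obtain ⟨M, g, hg1, hg⟩ := hp
    refine ⟨M + 1, g * Polynomial.C (X i), by simp [hg1], ?_⟩
    intro x μ hμ
    simp [hg x μ hμ]
    field_simp
    ring

theorem exists_pullback_genericNorm {r s r' s' : ℕ}
    {f : Matrix (Fin r) (Fin s) ℂ → Matrix (Fin r') (Fin s') ℂ} (hf : IsPolyMapI f) :
    ∃ G : MvPolynomial ((Fin r × Fin s) ⊕ (Fin r × Fin s)) ℂ, ∀ Z W,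
      MvPolynomial.eval (polarPoint Z (W.map (starRingEnd ℂ))) G = (1 - f Z * (f W)ᴴ).det := by
  choose p hp using hf
  let A : Matrix (Fin r') (Fin s') (MvPolynomial ((Fin r × Fin s) ⊕ (Fin r × Fin s)) ℂ) :=
    Matrix.of fun i j => MvPolynomial.rename Sum.inl (p i j)
  let B : Matrix (Fin s') (Fin r') (MvPolynomial ((Fin r × Fin s) ⊕ (Fin r × Fin s)) ℂ) :=
    Matrix.of fun i j => MvPolynomial.rename Sum.inr (MvPolynomial.map (starRingEnd ℂ) (p j i))
  refine ⟨(1 - A * B).det, ?_⟩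
  intro Z W
  rw [RingHom.map_det]
  have h1 : ∀ i j, MvPolynomial.eval (polarPoint Z (W.map (starRingEnd ℂ)))
      (MvPolynomial.rename Sum.inl (p i j)) = f Z i j := by
    intro i j
    rw [MvPolynomial.eval_rename, hp]
    rfl
  have h2 : ∀ i j, MvPolynomial.eval (polarPoint Z (W.map (starRingEnd ℂ)))
      (MvPolynomial.rename Sum.inr (MvPolynomial.map (starRingEnd ℂ) (p i j))) =
        starRingEnd ℂ (f W i j) := by
    intro i j
    rw [MvPolynomial.eval_rename, hp, MvPolynomial.eval_map, ← MvPolynomial.eval₂_id,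
      MvPolynomial.hom_eval₂]
    rfl
  congr 1
  rw [RingHom.mapMatrix_apply, Matrix.map_sub _ (map_sub _), Matrix.map_one _ (map_zero _)
    (map_one _), Matrix.map_mul]
  congr 2
  · ext i j
    exact h1 i j
  · ext i j
    exact h2 j i

theorem IsPolyMapI.continuous {r s r' s' : ℕ}
    {f : Matrix (Fin r) (Fin s) ℂ → Matrix (Fin r') (Fin s') ℂ} (hf : IsPolyMapI f) :
    Continuous f := by
  refine continuous_matrix fun i j => ?_
  obtain ⟨p, hp⟩ := hf i j
  simp only [hp]
  exact p.continuous_eval.comp (by fun_prop)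

/-- Radial boundary points of the source are mapped to the zero set of the generic norm. -/
theorem det_eq_zero_of_radial_boundary {r s r' s' : ℕ}
    {f : Matrix (Fin r) (Fin s) ℂ → Matrix (Fin r') (Fin s') ℂ} (hf : IsPolyMapI f)
    (hfmaps : Set.MapsTo f (OmegaI r s) (OmegaI r' s'))
    (hfproper : IsProperOn f (OmegaI r s) (OmegaI r' s'))
    {Z : Matrix (Fin r) (Fin s) ℂ} (hZ : Z ∉ OmegaI r s)
    (hrad : ∀ t : ℝ, 0 ≤ t → t < 1 → (t : ℂ) • Z ∈ OmegaI r s) :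
    (1 - f Z * (f Z)ᴴ).det = 0 := by
  by_contra hdet
  have hγ : Continuous fun t : ℝ => (t : ℂ) • Z := by fun_prop
  have hfγ : Continuous fun t : ℝ => f ((t : ℂ) • Z) := hf.continuous.comp hγ
  have hcl : (1 : ℝ) ∈ closure (Set.Ico (0 : ℝ) 1) := by
    rw [closure_Ico (by norm_num)]; simp
  have hpsd : (1 - f Z * (f Z)ᴴ).PosSemidef := by
    refine Matrix.PosSemidef.of_dotProduct_mulVec_nonneg ?_ fun x => ?_
    · exact Matrix.isHermitian_one.sub (Matrix.isHermitian_mul_conjTranspose_self _)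
    · have hc : IsClosed {t : ℝ | 0 ≤ star x ⬝ᵥ
          ((1 - f ((t : ℂ) • Z) * (f ((t : ℂ) • Z))ᴴ) *ᵥ x)} :=
        isClosed_le continuous_const (continuous_const.dotProduct ((continuous_const.sub
          (hfγ.matrix_mul hfγ.matrix_conjTranspose)).matrix_mulVec continuous_const))
      have := hc.closure_subset_iff.2 (fun t ht =>
        (hfmaps (hrad t ht.1 ht.2)).posSemidef.dotProduct_mulVec_nonneg x) hcl
      simpa using this
  have hpd : f Z ∈ OmegaI r' s' := hpsd.posDef_iff_det_ne_zero.2 hdet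
  have hK : IsCompact ((fun t : ℝ => f ((t : ℂ) • Z)) '' Set.Icc 0 1) :=
    isCompact_Icc.image hfγ
  have hpre := hfproper _ (by
    rintro _ ⟨t, ht, rfl⟩
    rcases ht.2.lt_or_eq with h | h
    · exact hfmaps (hrad t ht.1 h)
    · simpa [h] using hpd) hK
  have hc2 := hpre.isClosed.preimage hγ
  have := hc2.closure_subset_iff.2 (fun t (ht : t ∈ Set.Ico (0 : ℝ) 1) =>
    ⟨hrad t ht.1 ht.2, ⟨t, ⟨ht.1, ht.2.le⟩, rfl⟩⟩) hcl
  exact hZ (by simpa using this.1)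

theorem one_sub_mul_conjTranspose_of_diagonal {r s : ℕ} {U : Matrix (Fin r) (Fin r) ℂ}
    {L : Matrix (Fin r) (Fin s) ℂ} (hU : U * Uᴴ = 1) (hL : L * Lᴴ = 1) (z : Fin r → ℂ) :
    1 - (U * diagonal z * L) * (U * diagonal z * L)ᴴ =
      U * diagonal (fun k => 1 - z k * star (z k)) * Uᴴ := by
  have h1 : (U * diagonal z * L) * (U * diagonal z * L)ᴴ =
      U * diagonal (fun k => z k * star (z k)) * Uᴴ := by
    calc _ = U * diagonal z * (L * Lᴴ) * (diagonal (star z) * Uᴴ) := by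
            simp only [conjTranspose_mul, diagonal_conjTranspose, Matrix.mul_assoc]
      _ = U * (diagonal z * diagonal (star z)) * Uᴴ := by
            rw [hL]; simp only [Matrix.mul_assoc, Matrix.mul_one]
      _ = _ := by rw [diagonal_mul_diagonal]; rfl
  have h2 : diagonal (fun k => 1 - z k * star (z k)) =
      1 - diagonal (fun k => z k * star (z k)) := by
    rw [← diagonal_one, diagonal_sub]
  rw [h1, h2, Matrix.mul_sub, Matrix.sub_mul, Matrix.mul_one, hU]

theorem mem_OmegaI_of_diagonal {r s : ℕ} {U : Matrix (Fin r) (Fin r) ℂ}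
    {L : Matrix (Fin r) (Fin s) ℂ} (hU : U * Uᴴ = 1) (hL : L * Lᴴ = 1) {z : Fin r → ℂ}
    (hz : ∀ k, ‖z k‖ < 1) : U * diagonal z * L ∈ OmegaI r s := by
  rw [OmegaI, Set.mem_ofPred_eq, one_sub_mul_conjTranspose_of_diagonal hU hL]
  refine (PosDef.diagonal fun k => ?_).mul_mul_conjTranspose_same
    (Matrix.vecMul_injective_of_isUnit ?_)
  · have h : z k * star (z k) = ((‖z k‖ ^ 2 : ℝ) : ℂ) := by
      rw [Complex.star_def, Complex.mul_conj, Complex.normSq_eq_norm_sq]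
    rw [h, ← Complex.ofReal_one, ← Complex.ofReal_sub, Complex.zero_lt_real]
    nlinarith [hz k, norm_nonneg (z k)]
  · exact IsUnit.of_mul_eq_one _ hU

theorem notMem_OmegaI_of_diagonal {r s : ℕ} {U : Matrix (Fin r) (Fin r) ℂ}
    {L : Matrix (Fin r) (Fin s) ℂ} (hU : U * Uᴴ = 1) (hL : L * Lᴴ = 1) {z : Fin r → ℂ}
    {k : Fin r} (hz : ‖z k‖ = 1) : U * diagonal z * L ∉ OmegaI r s := by
  intro h
  rw [OmegaI, Set.mem_ofPred_eq, one_sub_mul_conjTranspose_of_diagonal hU hL] at h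
  refine h.det_pos.ne' ?_
  rw [det_mul, det_mul, det_diagonal, Finset.prod_eq_zero (Finset.mem_univ k), mul_zero, zero_mul]
  rw [Complex.star_def, Complex.mul_conj, Complex.normSq_eq_norm_sq, hz]
  simp

/-- The polarized pullback of the target norm vanishes on the complexification of each
boundary piece obtained by fixing one singular value to be `1`. -/
theorem eval_polarPoint_diagonal_eq_zero {r s r' s' : ℕ}
    {f : Matrix (Fin r) (Fin s) ℂ → Matrix (Fin r') (Fin s') ℂ} (hf : IsPolyMapI f)
    (hfmaps : Set.MapsTo f (OmegaI r s) (OmegaI r' s'))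
    (hfproper : IsProperOn f (OmegaI r s) (OmegaI r' s'))
    {G : MvPolynomial ((Fin r × Fin s) ⊕ (Fin r × Fin s)) ℂ}
    (hG : ∀ Z W, MvPolynomial.eval (polarPoint Z (W.map (starRingEnd ℂ))) G =
      (1 - f Z * (f W)ᴴ).det)
    {U : Matrix (Fin r) (Fin r) ℂ} {L : Matrix (Fin r) (Fin s) ℂ}
    (hU : U * Uᴴ = 1) (hL : L * Lᴴ = 1) {z v : Fin r → ℂ} {k : Fin r}
    (hzk : ‖z k‖ = 1) (hvk : v k = starRingEnd ℂ (z k)) :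
    MvPolynomial.eval (polarPoint (U * diagonal z * L)
      (U.map (starRingEnd ℂ) * diagonal v * L.map (starRingEnd ℂ))) G = 0 := by
  classical
  let zc : Fin r → MvPolynomial (Fin r ⊕ Fin r) ℂ := fun j =>
    if j = k then MvPolynomial.C (z k) else MvPolynomial.X (Sum.inl j)
  let vc : Fin r → MvPolynomial (Fin r ⊕ Fin r) ℂ := fun j =>
    if j = k then MvPolynomial.C (v k) else MvPolynomial.X (Sum.inr j)
  let φ : (Fin r × Fin s) ⊕ (Fin r × Fin s) → MvPolynomial (Fin r ⊕ Fin r) ℂ := Sum.elim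
    (fun q => ∑ j, MvPolynomial.C (U q.1 j) * zc j * MvPolynomial.C (L j q.2))
    (fun q => ∑ j, MvPolynomial.C (starRingEnd ℂ (U q.1 j)) * vc j *
      MvPolynomial.C (starRingEnd ℂ (L j q.2)))
  have hφ : ∀ y : Fin r ⊕ Fin r → ℂ, (fun q => MvPolynomial.eval y (φ q)) =
      polarPoint (U * diagonal (Function.update (y ∘ Sum.inl) k (z k)) * L)
        (U.map (starRingEnd ℂ) * diagonal (Function.update (y ∘ Sum.inr) k (v k)) *
          L.map (starRingEnd ℂ)) := by
    intro y
    have h1 : ∀ j, MvPolynomial.eval y (zc j) = Function.update (y ∘ Sum.inl) k (z k) j := by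
      intro j
      by_cases h : j = k <;> simp [zc, h]
    have h2 : ∀ j, MvPolynomial.eval y (vc j) = Function.update (y ∘ Sum.inr) k (v k) j := by
      intro j
      by_cases h : j = k <;> simp [vc, h]
    funext q
    rcases q with q | q
    · simp only [polarPoint, Sum.elim_inl]
      rw [Matrix.mul_apply]
      simp [φ, Matrix.mul_diagonal, h1]
    · simp only [polarPoint, Sum.elim_inr]
      rw [Matrix.mul_apply]
      simp [φ, Matrix.mul_diagonal, h2]
  have hzero : MvPolynomial.bind₁ φ G = 0 := by
    refine MvPolynomial.eq_zero_of_eval_conj_eq_zero _ fun x hx => ?_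
    rw [MvPolynomial.eval_bind₁_apply, hφ]
    set w : Fin r → ℂ := Function.update x k (z k) with hw
    have hV : U.map (starRingEnd ℂ) * diagonal (Function.update
        (Sum.elim x (fun j => starRingEnd ℂ (x j)) ∘ Sum.inr) k (v k)) * L.map (starRingEnd ℂ) =
        (U * diagonal w * L).map (starRingEnd ℂ) := by
      rw [Matrix.map_mul, Matrix.map_mul, Matrix.diagonal_map (map_zero _)]
      congr 3
      funext j
      by_cases h : j = k
      · subst h; simp [hw, hvk]
      · simp [hw, h]
    rw [hV, Sum.elim_comp_inl, ← hw, hG]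
    have hwk : ‖w k‖ = 1 := by simp [hw, hzk]
    refine det_eq_zero_of_radial_boundary hf hfmaps hfproper
      (notMem_OmegaI_of_diagonal hU hL hwk) fun t ht0 ht1 => ?_
    have : (t : ℂ) • (U * diagonal w * L) = U * diagonal ((t : ℂ) • w) * L := by
      rw [diagonal_smul, Matrix.mul_smul, Matrix.smul_mul]
    rw [this]
    refine mem_OmegaI_of_diagonal hU hL fun j => ?_
    have hwj : ‖w j‖ ≤ 1 := by
      by_cases h : j = k
      · subst h; exact hwk.le
      · simpa [hw, h] using (hx j).le
    simp only [Pi.smul_apply, smul_eq_mul, norm_mul, Complex.norm_real, Real.norm_eq_abs,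
      abs_of_nonneg ht0]
    nlinarith [norm_nonneg (w j)]
  have h := congrArg (MvPolynomial.eval (Sum.elim z v)) hzero
  rw [MvPolynomial.eval_bind₁_apply, hφ, map_zero] at h
  simpa using h

/-- A singular value decomposition for matrices of full row rank. -/
theorem exists_eq_mul_diagonal_mul {r s : ℕ} {Z : Matrix (Fin r) (Fin s) ℂ}
    (hZ : (Z * Zᴴ).det ≠ 0) :
    ∃ (U : Matrix (Fin r) (Fin r) ℂ) (σ : Fin r → ℝ) (L : Matrix (Fin r) (Fin s) ℂ),
      U * Uᴴ = 1 ∧ L * Lᴴ = 1 ∧ (∀ i, 0 < σ i) ∧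
        Z = U * diagonal (fun i => (σ i : ℂ)) * L := by
  have hpd : (Z * Zᴴ).PosDef :=
    (Matrix.posSemidef_self_mul_conjTranspose Z).posDef_iff_det_ne_zero.2 hZ
  have hev := hpd.eigenvalues_pos
  set lam := hpd.1.eigenvalues
  set U : Matrix (Fin r) (Fin r) ℂ := (hpd.1.eigenvectorUnitary).1
  have hU : U * Uᴴ = 1 := Unitary.coe_mul_star_self hpd.1.eigenvectorUnitary
  have hU' : Uᴴ * U = 1 := Unitary.coe_star_mul_self hpd.1.eigenvectorUnitary
  have hspec : Z * Zᴴ = U * diagonal (fun i => (lam i : ℂ)) * Uᴴ := hpd.1.spectral_theorem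
  have hσ : ∀ i, 0 < √(lam i) := fun i => Real.sqrt_pos.2 (hev i)
  set D : Matrix (Fin r) (Fin r) ℂ := diagonal (fun i => ((√(lam i) : ℝ) : ℂ)⁻¹) with hD
  have hDH : Dᴴ = D := by
    rw [hD, diagonal_conjTranspose]
    congr 1
    funext i
    simp
  refine ⟨U, fun i => √(lam i), D * Uᴴ * Z, hU, ?_, hσ, ?_⟩
  · calc D * Uᴴ * Z * (D * Uᴴ * Z)ᴴ = D * Uᴴ * (Z * Zᴴ) * (U * D) := by
          simp only [conjTranspose_mul, conjTranspose_conjTranspose, hDH, Matrix.mul_assoc]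
      _ = D * (Uᴴ * U) * diagonal (fun i => (lam i : ℂ)) * (Uᴴ * U) * D := by
          rw [hspec]; simp only [Matrix.mul_assoc]
      _ = 1 := by
          rw [hU', Matrix.mul_one, Matrix.mul_one, hD, diagonal_mul_diagonal,
            diagonal_mul_diagonal, ← diagonal_one]
          congr 1
          funext i
          have h0 : ((√(lam i) : ℝ) : ℂ) ≠ 0 := by exact_mod_cast (hσ i).ne'
          have h1 : (lam i : ℂ) = (√(lam i) : ℝ) * (√(lam i) : ℝ) := by
            exact_mod_cast (Real.mul_self_sqrt (hev i).le).symm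
          rw [h1]
          field_simp
  · have h1 : diagonal (fun i => ((√(lam i) : ℝ) : ℂ)) * D = 1 := by
      rw [hD, diagonal_mul_diagonal, ← diagonal_one]
      congr 1
      funext i
      exact mul_inv_cancel₀ (by exact_mod_cast (hσ i).ne')
    calc Z = U * (diagonal (fun i => ((√(lam i) : ℝ) : ℂ)) * D) * Uᴴ * Z := by
          rw [h1, Matrix.mul_one, hU, Matrix.one_mul]
      _ = _ := by simp only [Matrix.mul_assoc]

theorem charpoly_mul_conjTranspose_of_diagonal {r s : ℕ} {U : Matrix (Fin r) (Fin r) ℂ}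
    {L : Matrix (Fin r) (Fin s) ℂ} (hU : U * Uᴴ = 1) (hL : L * Lᴴ = 1) (σ : Fin r → ℝ) :
    ((U * diagonal (fun i => (σ i : ℂ)) * L) *
      (U * diagonal (fun i => (σ i : ℂ)) * L)ᴴ).charpoly =
        ∏ i, (Polynomial.X - Polynomial.C ((σ i : ℂ) ^ 2)) := by
  have h : (U * diagonal (fun i => (σ i : ℂ)) * L) *
      (U * diagonal (fun i => (σ i : ℂ)) * L)ᴴ =
        U * (diagonal (fun i => (σ i : ℂ) ^ 2) * Uᴴ) := by
    calc _ = U * diagonal (fun i => (σ i : ℂ)) * (L * Lᴴ) *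
          (diagonal (star fun i => (σ i : ℂ)) * Uᴴ) := by
            simp only [conjTranspose_mul, diagonal_conjTranspose, Matrix.mul_assoc]
      _ = U * ((diagonal (fun i => (σ i : ℂ)) * diagonal (star fun i => (σ i : ℂ))) * Uᴴ) := by
            rw [hL]; simp only [Matrix.mul_assoc, Matrix.mul_one]
      _ = _ := by
            rw [diagonal_mul_diagonal]
            congr 3
            funext i
            simp [sq]
  rw [h, charpoly_mul_comm, Matrix.mul_assoc, mul_eq_one_comm.1 hU, Matrix.mul_one,
    charpoly_diagonal]

theorem expand_two_prod_dvd {r : ℕ} {σ : Fin r → ℝ} (hσ : ∀ i, 0 < σ i)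
    (hinj : Function.Injective σ) {g : Polynomial ℂ}
    (hg : ∀ i, g.eval (σ i : ℂ) = 0 ∧ g.eval (-(σ i : ℂ)) = 0) :
    Polynomial.expand ℂ 2 (∏ i, (Polynomial.X - Polynomial.C ((σ i : ℂ) ^ 2))) ∣ g := by
  rw [map_prod]
  refine Finset.prod_dvd_of_coprime (fun i _ j _ hij => ?_) fun i _ => ?_
  · refine IsCoprime.map (Polynomial.isCoprime_X_sub_C_of_isUnit_sub ?_)
      (Polynomial.expand ℂ 2).toRingHom
    refine (sub_ne_zero.2 fun h => hij (hinj ?_)).isUnit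
    exact (pow_left_inj₀ (hσ i).le (hσ j).le two_ne_zero).1 (by exact_mod_cast h)
  · have h : Polynomial.expand ℂ 2 (Polynomial.X - Polynomial.C ((σ i : ℂ) ^ 2)) =
        (Polynomial.X - Polynomial.C (σ i : ℂ)) * (Polynomial.X - Polynomial.C (-(σ i : ℂ))) := by
      simp
      ring
    rw [h]
    refine IsCoprime.mul_dvd (Polynomial.isCoprime_X_sub_C_of_isUnit_sub ?_)
      (Polynomial.dvd_iff_isRoot.2 (hg i).1) (Polynomial.dvd_iff_isRoot.2 (hg i).2)
    refine IsUnit.mk0 _ ?_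
    rw [sub_neg_eq_add, ← two_mul]
    exact mul_ne_zero two_ne_zero (by exact_mod_cast (hσ i).ne')

theorem eventually_injective_add_mul {r : ℕ} (σ : Fin r → ℝ) :
    ∀ᶠ ε in nhdsWithin (0 : ℝ) (Set.Ioi 0),
      Function.Injective fun i : Fin r => σ i + ε * ((i : ℕ) + 1 : ℝ) := by
  have h : ∀ i j : Fin r, ∀ᶠ ε in nhdsWithin (0 : ℝ) (Set.Ioi 0),
      σ i + ε * ((i : ℕ) + 1 : ℝ) = σ j + ε * ((j : ℕ) + 1 : ℝ) → i = j := by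
    intro i j
    by_cases hij : i = j
    · exact Filter.Eventually.of_forall fun _ _ => hij
    have hne : ((i : ℕ) : ℝ) - (j : ℕ) ≠ 0 := by
      rw [sub_ne_zero]
      exact_mod_cast fun h => hij (Fin.ext h)
    have hev : ∀ᶠ ε in nhdsWithin (0 : ℝ) (Set.Ioi 0),
        ε ≠ (σ j - σ i) / (((i : ℕ) : ℝ) - (j : ℕ)) := by
      by_cases h0 : (σ j - σ i) / (((i : ℕ) : ℝ) - (j : ℕ)) = 0
      · rw [h0]
        filter_upwards [self_mem_nhdsWithin] with ε hε using (Set.mem_Ioi.1 hε).ne'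
      · exact nhdsWithin_le_nhds (eventually_ne_nhds (Ne.symm h0))
    filter_upwards [hev] with ε hε heq
    refine absurd ?_ hε
    rw [eq_div_iff hne]
    linarith
  filter_upwards [Filter.eventually_all.2 fun i => Filter.eventually_all.2 (h i)]
    with ε hε i j hij using hε i j hij

/-- The matrix `Z * Vᵀ` with polynomial entries. -/
def polarGram (r s : ℕ) :
    Matrix (Fin r) (Fin r) (MvPolynomial ((Fin r × Fin s) ⊕ (Fin r × Fin s)) ℂ) :=
  Matrix.of fun i j => ∑ k, MvPolynomial.X (Sum.inl (i, k)) * MvPolynomial.X (Sum.inr (j, k))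

theorem polarGram_map_eval {r s : ℕ} (Z V : Matrix (Fin r) (Fin s) ℂ) :
    (polarGram r s).map (MvPolynomial.eval (polarPoint Z V)) = Z * Vᵀ := by
  ext i j
  simp [polarGram, polarPoint, Matrix.mul_apply]

theorem polarGram_det_ne_zero {r s : ℕ} (hrs : r ≤ s) : (polarGram r s).det ≠ 0 := by
  intro h
  let E : Matrix (Fin r) (Fin s) ℂ := Matrix.of fun i j => if Fin.castLE hrs i = j then 1 else 0
  have hE : E * Eᵀ = 1 := by
    ext i j
    simp [E, Matrix.mul_apply, Matrix.one_apply, eq_comm]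
  have := congrArg (MvPolynomial.eval (polarPoint E E)) h
  rw [RingHom.map_det, RingHom.mapMatrix_apply, polarGram_map_eval, hE, det_one, map_zero] at this
  exact one_ne_zero this

/-- A polynomial vanishing at all `(Z, conj Z)` with distinct nonzero singular values is zero. -/
theorem eq_zero_of_eval_diagonal {r s : ℕ} (hrs : r ≤ s)
    (c : MvPolynomial ((Fin r × Fin s) ⊕ (Fin r × Fin s)) ℂ)
    (hc : ∀ (U : Matrix (Fin r) (Fin r) ℂ) (σ : Fin r → ℝ) (L : Matrix (Fin r) (Fin s) ℂ),
      U * Uᴴ = 1 → L * Lᴴ = 1 → (∀ i, 0 < σ i) → Function.Injective σ →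
        MvPolynomial.eval (polarPoint (U * diagonal (fun i => (σ i : ℂ)) * L)
          ((U * diagonal (fun i => (σ i : ℂ)) * L).map (starRingEnd ℂ))) c = 0) : c = 0 := by
  suffices c * (polarGram r s).det = 0 from
    (mul_eq_zero.1 this).resolve_right (polarGram_det_ne_zero hrs)
  refine MvPolynomial.eq_zero_of_eval_conj_eq_zero _ fun x _ => ?_
  set Z : Matrix (Fin r) (Fin s) ℂ := Matrix.of fun i j => x (i, j) with hZ
  have hx : Sum.elim x (fun j => starRingEnd ℂ (x j)) =
      polarPoint Z (Z.map (starRingEnd ℂ)) := by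
    funext q
    rcases q with q | q <;> rfl
  have hH : (Z.map (starRingEnd ℂ))ᵀ = Zᴴ := rfl
  rw [hx, map_mul, RingHom.map_det, RingHom.mapMatrix_apply, polarGram_map_eval, hH]
  by_cases hdet : (Z * Zᴴ).det = 0
  · rw [hdet, mul_zero]
  obtain ⟨U, σ, L, hU, hL, hσ, hZU⟩ := exists_eq_mul_diagonal_mul hdet
  let γ : ℝ → Matrix (Fin r) (Fin s) ℂ := fun ε =>
    U * diagonal (fun i : Fin r => ((σ i + ε * ((i : ℕ) + 1 : ℝ) : ℝ) : ℂ)) * L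
  have hγ : Continuous γ := by
    refine (continuous_const.matrix_mul (Continuous.matrix_diagonal ?_)).matrix_mul
      continuous_const
    fun_prop
  have hγ0 : γ 0 = Z := by simp [γ, ← hZU]
  have hcont : Continuous fun ε =>
      MvPolynomial.eval (polarPoint (γ ε) ((γ ε).map (starRingEnd ℂ))) c := by
    refine c.continuous_eval.comp (continuous_pi fun q => ?_)
    rcases q with q | q
    · exact hγ.matrix_elem q.1 q.2
    · exact Complex.continuous_conj.comp (hγ.matrix_elem q.1 q.2)
  have hlim := (hcont.tendsto 0).mono_left
    (nhdsWithin_le_nhds : nhdsWithin (0 : ℝ) (Set.Ioi 0) ≤ nhds 0)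
  have hzero := tendsto_nhds_unique_of_eventuallyEq hlim
    (tendsto_const_nhds (x := (0 : ℂ))) (by
      filter_upwards [eventually_injective_add_mul σ, self_mem_nhdsWithin] with ε hε hpos
      refine hc U _ L hU hL (fun i => ?_) hε
      have := hσ i
      have := Set.mem_Ioi.1 hpos
      positivity)
  rw [hγ0] at hzero
  rw [hzero, zero_mul]

/-- The polarized divisibility identity (3.5)–(3.6), type I case: the polarized generic norm
of the source divides the pulled-back polarized generic norm of the target, with polynomial
quotient `F_f(Z, conj W)`. -/
theorem genericNorm_divides_typeI (r s r' s' : ℕ)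
    (hr : 1 ≤ r) (hrs : r ≤ s) (hr' : 1 ≤ r') (hrs' : r' ≤ s')
    (f : Matrix (Fin r) (Fin s) ℂ → Matrix (Fin r') (Fin s') ℂ)
    (hfpoly : IsPolyMapI f)
    (hfmaps : Set.MapsTo f (OmegaI r s) (OmegaI r' s'))
    (hfproper : IsProperOn f (OmegaI r s) (OmegaI r' s')) :
    ∃ F : Matrix (Fin r) (Fin s) ℂ → Matrix (Fin r) (Fin s) ℂ → ℂ,
      (∃ p : MvPolynomial ((Fin r × Fin s) ⊕ (Fin r × Fin s)) ℂ,
        ∀ Z V, F Z V = MvPolynomial.eval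
          (Sum.elim (fun q => Z q.1 q.2) (fun q => V q.1 q.2)) p) ∧
      ∀ Z W : Matrix (Fin r) (Fin s) ℂ,
        (1 - f Z * (f W)ᴴ).det = (1 - Z * Wᴴ).det * F Z (W.map (starRingEnd ℂ)) := by
  obtain ⟨G, hG⟩ := exists_pullback_genericNorm hfpoly
  obtain ⟨N, g, hg1, hg⟩ := G.exists_homogenization
  set d := Polynomial.expand _ 2 (polarGram r s).charpoly with hd
  have hmonic : d.Monic := (Matrix.charpoly_monic _).expand two_pos
  have hrem : g %ₘ d = 0 := by
    ext1 n
    refine eq_zero_of_eval_diagonal hrs _ fun U σ L hU hL hσ hinj => ?_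
    set Z := U * diagonal (fun i => (σ i : ℂ)) * L with hZ
    set x := polarPoint Z (Z.map (starRingEnd ℂ)) with hx
    have hdx : d.map (MvPolynomial.eval x) =
        Polynomial.expand ℂ 2 (∏ i, (Polynomial.X - Polynomial.C ((σ i : ℂ) ^ 2))) := by
      rw [hd, Polynomial.map_expand, ← Matrix.charpoly_map, polarGram_map_eval,
        ← charpoly_mul_conjTranspose_of_diagonal hU hL]
      rfl
    have hroot : ∀ (k : Fin r) (μ : ℝ), |μ| = σ k →
        (g.map (MvPolynomial.eval x)).eval (μ : ℂ) = 0 := by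
      intro k μ hμ
      have hμ0 : μ ≠ 0 := abs_pos.1 (hμ ▸ hσ k)
      have hμc : (μ : ℂ) ≠ 0 := by exact_mod_cast hμ0
      rw [hg x μ hμc]
      have hpt : (fun i => x i / (μ : ℂ)) =
          polarPoint (U * diagonal (fun i => ((σ i / μ : ℝ) : ℂ)) * L)
            (U.map (starRingEnd ℂ) * diagonal (fun i => ((σ i / μ : ℝ) : ℂ)) *
              L.map (starRingEnd ℂ)) := by
        funext q
        rcases q with q | q
        · simp only [hx, hZ, polarPoint, Sum.elim_inl]
          rw [Matrix.mul_apply, Matrix.mul_apply, Finset.sum_div]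
          refine Finset.sum_congr rfl fun j _ => ?_
          simp only [Matrix.mul_diagonal, Complex.ofReal_div]
          ring
        · simp only [hx, hZ, polarPoint, Sum.elim_inr, Matrix.map_apply]
          rw [Matrix.mul_apply, Matrix.mul_apply, map_sum, Finset.sum_div]
          refine Finset.sum_congr rfl fun j _ => ?_
          simp only [Matrix.mul_diagonal, Complex.ofReal_div, map_mul, Complex.conj_ofReal,
            Matrix.map_apply]
          ring
      rw [hpt, eval_polarPoint_diagonal_eq_zero hfpoly hfmaps hfproper hG hU hL (k := k)
        (by rw [Complex.norm_real, Real.norm_eq_abs, abs_div, hμ, abs_of_pos (hσ k),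
              div_self (hσ k).ne'])
        (Complex.conj_ofReal _).symm, mul_zero]
    have hdvd : d.map (MvPolynomial.eval x) ∣ g.map (MvPolynomial.eval x) := by
      rw [hdx]
      refine expand_two_prod_dvd hσ hinj fun i => ⟨hroot i (σ i) (abs_of_pos (hσ i)), ?_⟩
      have := hroot i (-σ i) (by rw [abs_neg, abs_of_pos (hσ i)])
      simpa using this
    rw [← Polynomial.coeff_map, Polynomial.map_modByMonic _ hmonic,
      (Polynomial.modByMonic_eq_zero_iff_dvd (hmonic.map _)).2 hdvd, Polynomial.coeff_zero]
  obtain ⟨Q, hQ⟩ := (Polynomial.modByMonic_eq_zero_iff_dvd hmonic).1 hrem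
  refine ⟨fun Z V => MvPolynomial.eval (polarPoint Z V) (Q.eval 1), ⟨Q.eval 1, fun Z V => rfl⟩,
    fun Z W => ?_⟩
  rw [← hG, ← hg1, hQ, Polynomial.eval_mul, map_mul, hd, Polynomial.expand_eval, one_pow,
    Matrix.eval_charpoly, RingHom.map_det, RingHom.mapMatrix_apply, map_one,
    Matrix.map_sub _ (map_sub _), Matrix.map_one _ (map_zero _) (map_one _), polarGram_map_eval]
  rfl
end
end

section
/- Let 1 ≤ r ≤ s and 1 ≤ r' ≤ s', and let f : Matrix (Fin r) (Fin s) ℂ → Matrix (Fin r') (Fin s') ℂ be a holomorphic polynomial map that maps Ω^I_{r,s} into Ω^I_{r',s'} and whose restriction Ω^I_{r,s} → Ω^I_{r',s'} is proper. If Z₀ ∈ Matrix (Fin r) (Fin s) ℂ satisfies that I_r − Z₀ Z₀ᴴ is positive semidefinite and det(I_r − Z₀ Z₀ᴴ) = 0, then det(I_{r'} − f(Z₀) f(Z₀)ᴴ) = 0. -/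
open Matrix
open scoped ComplexOrder

noncomputable section

/-- The closure condition `1 - Z Zᴴ ≥ 0` is closed. -/
theorem isClosed_setOf_one_sub_mul_conjTranspose_posSemidef (r s : ℕ) :
    IsClosed {Z : Matrix (Fin r) (Fin s) ℂ | (1 - Z * Zᴴ).PosSemidef} := by
  have hH (Z : Matrix (Fin r) (Fin s) ℂ) : (1 - Z * Zᴴ).IsHermitian :=
    isHermitian_one.sub (isHermitian_mul_conjTranspose_self Z)
  simp only [Matrix.posSemidef_iff_dotProduct_mulVec, hH, true_and, Set.ofPred_forall]
  exact isClosed_iInter fun x => isClosed_le continuous_const (by fun_prop)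

/-- Real contractions of a point of the closure lie in the domain. -/
theorem smul_mem_OmegaI {r s : ℕ} {Z : Matrix (Fin r) (Fin s) ℂ}
    (hZ : (1 - Z * Zᴴ).PosSemidef) {t : ℝ} (ht₀ : 0 ≤ t) (ht₁ : t < 1) :
    t • Z ∈ OmegaI r s := by
  have h : 1 - (t • Z) * (t • Z)ᴴ =
      (1 - t ^ 2) • (1 : Matrix (Fin r) (Fin r) ℂ) + t ^ 2 • (1 - Z * Zᴴ) := by
    simp only [conjTranspose_smul, star_trivial, Matrix.smul_mul, Matrix.mul_smul]
    module
  change (1 - (t • Z) * (t • Z)ᴴ).PosDef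
  rw [h]
  exact (Matrix.PosDef.one.smul (by nlinarith : 0 < 1 - t ^ 2)).add_posSemidef (hZ.smul (sq_nonneg t))

/-- The boundary-to-boundary property of Section 3, type I case: the generic norm of the target
vanishes at `f(Z₀)` whenever the generic norm of the source vanishes at `Z₀` on the closure. -/
theorem genericNorm_vanishes_on_boundary_typeI (r s r' s' : ℕ)
    (hr : 1 ≤ r) (hrs : r ≤ s) (hr' : 1 ≤ r') (hrs' : r' ≤ s')
    (f : Matrix (Fin r) (Fin s) ℂ → Matrix (Fin r') (Fin s') ℂ)
    (hfpoly : IsPolyMapI f)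
    (hfmaps : Set.MapsTo f (OmegaI r s) (OmegaI r' s'))
    (hfproper : IsProperOn f (OmegaI r s) (OmegaI r' s'))
    (Z₀ : Matrix (Fin r) (Fin s) ℂ)
    (hZ₀ : (1 - Z₀ * Z₀ᴴ).PosSemidef) (hdet : (1 - Z₀ * Z₀ᴴ).det = 0) :
    (1 - f Z₀ * (f Z₀)ᴴ).det = 0 := by
  by_contra hne
  have hg : Continuous fun t : ℝ => t • Z₀ := by fun_prop
  -- A closed set containing the segment `t • Z₀`, `0 ≤ t < 1`, contains its endpoint `Z₀`.
  have endpoint {C : Set (Matrix (Fin r) (Fin s) ℂ)} (hC : IsClosed C)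
      (h : ∀ t : ℝ, 0 ≤ t → t < 1 → t • Z₀ ∈ C) : Z₀ ∈ C := by
    have hcl : closure (Set.Ico (0 : ℝ) 1) ⊆ (fun t : ℝ => t • Z₀) ⁻¹' C :=
      closure_minimal (fun t ht => h t ht.1 ht.2) (hC.preimage hg)
    rw [closure_Ico zero_ne_one] at hcl
    simpa using hcl (Set.right_mem_Icc.2 zero_le_one)
  have hfZ₀ : f Z₀ ∈ OmegaI r' s' := by
    have hpsd : (1 - f Z₀ * (f Z₀)ᴴ).PosSemidef :=
      endpoint ((isClosed_setOf_one_sub_mul_conjTranspose_posSemidef r' s').preimage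
        hfpoly.continuous) fun t h₀ h₁ => (hfmaps (smul_mem_OmegaI hZ₀ h₀ h₁)).posSemidef
    exact hpsd.posDef_iff_det_ne_zero.2 hne
  set K := (fun t : ℝ => f (t • Z₀)) '' Set.Icc 0 1
  have hK : IsCompact K := isCompact_Icc.image (hfpoly.continuous.comp hg)
  have hKsub : K ⊆ OmegaI r' s' := by
    rintro _ ⟨t, ⟨h₀, h₁⟩, rfl⟩
    rcases h₁.lt_or_eq with h₁ | rfl
    · exact hfmaps (smul_mem_OmegaI hZ₀ h₀ h₁)
    · simpa using hfZ₀
  have hmem := endpoint (hfproper K hKsub hK).isClosed fun t h₀ h₁ =>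
    ⟨smul_mem_OmegaI hZ₀ h₀ h₁, t, ⟨h₀, h₁.le⟩, rfl⟩
  have hpd : (1 - Z₀ * Z₀ᴴ).PosDef := hmem.1
  exact hpd.det_pos.ne' hdet
end
end

section
/- Let r, s ≥ 1 and let A ∈ Matrix (Fin r) (Fin r) ℂ, B ∈ Matrix (Fin r) (Fin s) ℂ, C ∈ Matrix (Fin s) (Fin r) ℂ, D ∈ Matrix (Fin s) (Fin s) ℂ satisfy A Aᴴ − B Bᴴ = I_r, A Cᴴ = B Dᴴ, and C Cᴴ − D Dᴴ = −I_s. Then for all Z, W ∈ Matrix (Fin r) (Fin s) ℂ: (B + Z D)(B + W D)ᴴ = (A + Z C)(A + W C)ᴴ + Z Wᴴ − I_r. -/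
open Matrix

/-- The key matrix identity in the proof of Lemma 3.4: for a block matrix
`M = [[A,B],[C,D]] ∈ U(r,s)`, one has
`(B + ZD)(B + WD)ᴴ = (A + ZC)(A + WC)ᴴ + ZWᴴ − I_r`. -/
theorem block_unitary_identity (r s : ℕ) (hr : 1 ≤ r) (hs : 1 ≤ s)
    (A : Matrix (Fin r) (Fin r) ℂ) (B : Matrix (Fin r) (Fin s) ℂ)
    (C : Matrix (Fin s) (Fin r) ℂ) (D : Matrix (Fin s) (Fin s) ℂ)
    (hAB : A * Aᴴ - B * Bᴴ = 1) (hAC : A * Cᴴ = B * Dᴴ)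
    (hCD : C * Cᴴ - D * Dᴴ = -1) :
    ∀ Z W : Matrix (Fin r) (Fin s) ℂ,
      (B + Z * D) * (B + W * D)ᴴ = (A + Z * C) * (A + W * C)ᴴ + Z * Wᴴ - 1 := by
  intro Z W
  have hBB : B * Bᴴ = A * Aᴴ - 1 := by rw [← hAB, sub_sub_cancel]
  have hDD : D * Dᴴ = C * Cᴴ + 1 := by
    rw [← sub_eq_iff_eq_add', ← neg_sub, hCD, neg_neg]
  have hDB : D * Bᴴ = C * Aᴴ := by
    simpa using (congrArg conjTranspose hAC).symm
  calc (B + Z * D) * (B + W * D)ᴴ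
      = B * Bᴴ + B * Dᴴ * Wᴴ + Z * (D * Bᴴ) + Z * (D * Dᴴ) * Wᴴ := by
        simp only [conjTranspose_add, conjTranspose_mul, Matrix.mul_add, Matrix.add_mul,
          Matrix.mul_assoc]
        abel
    _ = (A + Z * C) * (A + W * C)ᴴ + Z * Wᴴ - 1 := by
        rw [hBB, ← hAC, hDB, hDD]
        simp only [conjTranspose_add, conjTranspose_mul, Matrix.mul_add, Matrix.add_mul,
          Matrix.mul_assoc, Matrix.one_mul]
        abel
end

section
/- Let r, s ≥ 1 and let A ∈ Matrix (Fin r) (Fin r) ℂ, B ∈ Matrix (Fin r) (Fin s) ℂ, C ∈ Matrix (Fin s) (Fin r) ℂ, D ∈ Matrix (Fin s) (Fin s) ℂ satisfy A Aᴴ − B Bᴴ = I_r, A Cᴴ = B Dᴴ, and C Cᴴ − D Dᴴ = −I_s. Let Z, W ∈ Matrix (Fin r) (Fin s) ℂ be such that A + Z C and A + W C are invertible, and set U(Z) = (A + Z C)⁻¹ (B + Z D) and U(W) = (A + W C)⁻¹ (B + W D). Then det(I_r − U(Z)·U(W)ᴴ) · det(A + Z C) · conj(det(A + W C)) = det(I_r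 − Z·Wᴴ). -/
open Matrix

/-- Lemma 3.4(1) (formula (3.8)): transformation rule for the polarized generic norm of the
type I domain under the fractional linear action `Z ↦ (A + ZC)⁻¹(B + ZD)` of `U(r,s)`. -/
theorem genericNorm_transformation_typeI (r s : ℕ) (hr : 1 ≤ r) (hs : 1 ≤ s)
    (A : Matrix (Fin r) (Fin r) ℂ) (B : Matrix (Fin r) (Fin s) ℂ)
    (C : Matrix (Fin s) (Fin r) ℂ) (D : Matrix (Fin s) (Fin s) ℂ)
    (hAB : A * Aᴴ - B * Bᴴ = 1) (hAC : A * Cᴴ = B * Dᴴ)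
    (hCD : C * Cᴴ - D * Dᴴ = -1)
    (Z W : Matrix (Fin r) (Fin s) ℂ)
    (hZ : IsUnit (A + Z * C)) (hW : IsUnit (A + W * C)) :
    (1 - ((A + Z * C)⁻¹ * (B + Z * D)) * ((A + W * C)⁻¹ * (B + W * D))ᴴ).det
        * (A + Z * C).det * (starRingEnd ℂ) ((A + W * C).det)
      = (1 - Z * Wᴴ).det := by
  have hCA : C * Aᴴ = D * Bᴴ := by
    simpa [conjTranspose_mul] using congrArg conjTranspose hAC
  have key : (A + Z * C) * (A + W * C)ᴴ - (B + Z * D) * (B + W * D)ᴴ = 1 - Z * Wᴴ := by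
    calc
      _ = (A * Aᴴ - B * Bᴴ) + Z * (C * Aᴴ - D * Bᴴ) + (A * Cᴴ - B * Dᴴ) * Wᴴ
          + Z * (C * Cᴴ - D * Dᴴ) * Wᴴ := by
        simp only [conjTranspose_add, conjTranspose_mul, Matrix.mul_add, Matrix.add_mul,
          Matrix.mul_sub, Matrix.sub_mul, Matrix.mul_assoc]
        abel
      _ = 1 - Z * Wᴴ := by
        rw [hAB, hCA, hAC, hCD]
        simp [sub_eq_add_neg]
  have hP : (A + Z * C) * (A + Z * C)⁻¹ = 1 :=
    mul_nonsing_inv _ ((isUnit_iff_isUnit_det _).mp hZ)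
  have hQ : ((A + W * C)⁻¹)ᴴ * (A + W * C)ᴴ = 1 := by
    rw [← conjTranspose_mul, mul_nonsing_inv _ ((isUnit_iff_isUnit_det _).mp hW),
      conjTranspose_one]
  have hfactor : (A + Z * C)
      * (1 - ((A + Z * C)⁻¹ * (B + Z * D)) * ((A + W * C)⁻¹ * (B + W * D))ᴴ)
      * (A + W * C)ᴴ = 1 - Z * Wᴴ := by
    rw [← key, conjTranspose_mul ((A + W * C)⁻¹), Matrix.mul_sub, Matrix.sub_mul,
      Matrix.mul_one, ← Matrix.mul_assoc, ← Matrix.mul_assoc, ← Matrix.mul_assoc, hP,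
      Matrix.one_mul, Matrix.mul_assoc _ _ (A + W * C)ᴴ, hQ, Matrix.mul_one]
  rw [← hfactor, det_mul, det_mul, det_conjTranspose, starRingEnd_apply]
  ring
end
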